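/- arXiv:1609.01425 — 7 statements merged into one kernel-verified Lean document; each statement's English description precedes it below -/
import Mathlib

section
/- Let G be a connected simple graph on n vertices with a vertex weight ω (a positive real-valued function on the vertices). Then LE_ω(G) ≤ n·MD_ω(G) + E(G). Moreover, equality holds if and only if G is ω-regular (i.e., ω is a constant function). -/
open Matrix Finset

set_option linter.unusedSectionVars false

variable {V : Type*} [Fintype V] [DecidableEq V]

/-- The adjacency matrix of a simple graph over `ℝ` is Hermitian. -/
lemma adjMatrix_isHermitian (G : SimpleGraph V) [DecidableRel G.Adj] :
    (G.adjMatrix ℝ).IsHermitian :=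
  Matrix.IsHermitian.ext fun i j => by
    simp [Matrix.IsHermitian, SimpleGraph.adjMatrix_apply, SimpleGraph.adj_comm]

/-- The weighted Laplacian matrix `D_ω(G) - A(G)` of a simple graph with
vertex weight `w`. -/
noncomputable def wLaplacian (G : SimpleGraph V) [DecidableRel G.Adj] (w : V → ℝ) :
    Matrix V V ℝ :=
  Matrix.diagonal w - G.adjMatrix ℝ

lemma wLaplacian_isHermitian (G : SimpleGraph V) [DecidableRel G.Adj] (w : V → ℝ) :
    (wLaplacian G w).IsHermitian :=
  (Matrix.isHermitian_diagonal w).sub (adjMatrix_isHermitian G)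

/-- The energy of a graph: the sum of the absolute values of the eigenvalues of
its adjacency matrix, `E(G) = Σ_i |λ_i|`. -/
noncomputable def graphEnergy (G : SimpleGraph V) [DecidableRel G.Adj] : ℝ :=
  ∑ i, |(adjMatrix_isHermitian G).eigenvalues i|

/-- The average `ω̄ = (Σ_v ω(v))/n` of a vertex weight. -/
noncomputable def avgWeight (w : V → ℝ) : ℝ :=
  (∑ v, w v) / (Fintype.card V : ℝ)

/-- The Laplacian energy of `G` with respect to the vertex weight `w`:
`LE_ω(G) = Σ_i |μ_i − ω̄|` where the `μ_i` are the eigenvalues of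
`D_ω(G) - A(G)`. -/
noncomputable def wLapEnergy (G : SimpleGraph V) [DecidableRel G.Adj] (w : V → ℝ) : ℝ :=
  ∑ i, |(wLaplacian_isHermitian G w).eigenvalues i - avgWeight w|

/-- The mean deviation of a vertex weight: `MD_ω(G) = (1/n) Σ_v |ω(v) − ω̄|`. -/
noncomputable def meanDev (w : V → ℝ) : ℝ :=
  (∑ v, |w v - avgWeight w|) / (Fintype.card V : ℝ)

lemma aux_spec {A : Matrix V V ℝ} (hA : A.IsHermitian) (c : ℝ) :
    ∃ U : Matrix V V ℝ, U * Uᵀ = 1 ∧ Uᵀ * U = 1 ∧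
      A - c • (1 : Matrix V V ℝ) = U * diagonal (fun i => hA.eigenvalues i - c) * Uᵀ := by
  have h1 := Unitary.coe_mul_star_self hA.eigenvectorUnitary
  have h2 := Unitary.coe_star_mul_self hA.eigenvectorUnitary
  have h3 := hA.spectral_theorem
  rw [Unitary.conjStarAlgAut_apply] at h3
  rw [Unitary.coe_star] at h1
  rw [star_eq_conjTranspose, conjTranspose_eq_transpose_of_trivial] at h1 h2 h3
  refine ⟨_, h1, h2, ?_⟩
  have h4 : diagonal (fun i => hA.eigenvalues i - c)
      = diagonal (RCLike.ofReal ∘ hA.eigenvalues) - c • (1 : Matrix V V ℝ) := by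
    rw [smul_one_eq_diagonal, diagonal_sub]
    rfl
  rw [h4, mul_sub, sub_mul, ← h3]
  simp [h1]

lemma aux_row {S : Matrix V V ℝ} (hs : Sᵀ = S) (ho : S * S = 1) (i : V) :
    ∑ k, S i k ^ 2 = 1 := by
  have h := congrFun (congrFun ho i) i
  rw [mul_apply, one_apply_eq] at h
  rw [← h]
  refine Finset.sum_congr rfl fun k _ => ?_
  have : S k i = S i k := congrFun (congrFun hs i) k
  rw [this, sq]

lemma aux_abs {S : Matrix V V ℝ} (hs : Sᵀ = S) (ho : S * S = 1) (i : V) :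
    |S i i| ≤ 1 := by
  rw [← sq_le_one_iff_abs_le_one, ← aux_row hs ho i]
  exact Finset.single_le_sum (f := fun k => S i k ^ 2) (fun k _ => sq_nonneg _) (mem_univ i)

lemma aux_off {S : Matrix V V ℝ} (hs : Sᵀ = S) (ho : S * S = 1) {i : V}
    (hi : S i i ^ 2 = 1) {k : V} (hk : k ≠ i) : S i k = 0 := by
  have h := aux_row hs ho i
  rw [← Finset.add_sum_erase _ _ (mem_univ i), hi] at h
  have h0 : ∑ x ∈ univ.erase i, S i x ^ 2 = 0 := by linarith
  rw [Finset.sum_eq_zero_iff_of_nonneg (fun k _ => sq_nonneg _)] at h0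
  exact pow_eq_zero_iff (two_ne_zero) |>.1 (h0 k (by simp [hk]))

lemma aux_mul_le {s d : ℝ} (hs : |s| ≤ 1) : s * d ≤ |d| := by
  calc s * d ≤ |s * d| := le_abs_self _
    _ = |s| * |d| := abs_mul _ _
    _ ≤ 1 * |d| := by gcongr
    _ = |d| := one_mul _

lemma aux_mul_eq {s d : ℝ} (h : s * d = |d|) (hd : d ≠ 0) : s ^ 2 = 1 := by
  have h2 : s ^ 2 * d ^ 2 = 1 * d ^ 2 := by rw [← mul_pow, h, sq_abs, one_mul]
  exact mul_right_cancel₀ (pow_ne_zero 2 hd) h2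

lemma aux_trace (S U : Matrix V V ℝ) (l : V → ℝ) :
    trace (S * (U * diagonal l * Uᵀ)) = ∑ j, (Uᵀ * S * U) j j * l j := by
  have : trace (S * (U * diagonal l * Uᵀ)) = trace (Uᵀ * S * U * diagonal l) := by
    rw [← Matrix.mul_assoc, trace_mul_comm]
    simp only [Matrix.mul_assoc]
  rw [this]
  simp [trace, mul_diagonal]

lemma aux_conj {S U : Matrix V V ℝ} (hs : Sᵀ = S) (ho : S * S = 1) (h1 : U * Uᵀ = 1)
    (h2 : Uᵀ * U = 1) : (Uᵀ * S * U)ᵀ = Uᵀ * S * U ∧ (Uᵀ * S * U) * (Uᵀ * S * U) = 1 := by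
  constructor
  · simp [transpose_mul, hs, Matrix.mul_assoc]
  · calc (Uᵀ * S * U) * (Uᵀ * S * U) = Uᵀ * S * (U * Uᵀ) * S * U := by
          simp only [Matrix.mul_assoc]
      _ = Uᵀ * (S * S) * U := by rw [h1]; simp only [Matrix.mul_assoc, Matrix.one_mul]
      _ = 1 := by rw [ho, Matrix.mul_one, h2]

/-- Sign matrix. -/
lemma aux_sign {A : Matrix V V ℝ} (hA : A.IsHermitian) (c : ℝ) :
    ∃ S : Matrix V V ℝ, Sᵀ = S ∧ S * S = 1 ∧
      trace (S * (A - c • (1 : Matrix V V ℝ))) = ∑ i, |hA.eigenvalues i - c| := by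
  obtain ⟨U, h1, h2, h3⟩ := aux_spec hA c
  set l : V → ℝ := fun i => hA.eigenvalues i - c with hl
  set s : V → ℝ := fun i => if 0 ≤ l i then 1 else -1 with hsd
  have hss : (diagonal s) * (diagonal s) = (1 : Matrix V V ℝ) := by
    rw [diagonal_mul_diagonal, ← diagonal_one]
    congr 1
    funext i
    simp only [hsd]
    split_ifs <;> norm_num
  have hc := aux_conj (S := diagonal s) (U := Uᵀ) (diagonal_transpose s) hss
    (by rwa [transpose_transpose]) (by rwa [transpose_transpose])
  rw [transpose_transpose] at hc
  refine ⟨_, hc.1, hc.2, ?_⟩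
  rw [h3, aux_trace]
  have h5 : Uᵀ * (U * diagonal s * Uᵀ) * U = diagonal s := by
    calc Uᵀ * (U * diagonal s * Uᵀ) * U = (Uᵀ * U) * diagonal s * (Uᵀ * U) := by
          simp only [Matrix.mul_assoc]
      _ = _ := by rw [h2, Matrix.one_mul, Matrix.mul_one]
  rw [h5]
  refine Finset.sum_congr rfl fun i _ => ?_
  rw [diagonal_apply_eq]
  change s i * l i = |l i|
  simp only [hsd]
  split_ifs with h
  · rw [abs_of_nonneg h, one_mul]
  · rw [abs_of_neg (not_le.1 h)]; ring

lemma aux_upper {A : Matrix V V ℝ} (hA : A.IsHermitian) (c : ℝ) {S : Matrix V V ℝ}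
    (hs : Sᵀ = S) (ho : S * S = 1) :
    -trace (S * (A - c • (1 : Matrix V V ℝ))) ≤ ∑ i, |hA.eigenvalues i - c| := by
  obtain ⟨U, h1, h2, h3⟩ := aux_spec hA c
  rw [h3, aux_trace, ← Finset.sum_neg_distrib]
  obtain ⟨t1, t2⟩ := aux_conj hs ho h1 h2
  refine Finset.sum_le_sum fun i _ => ?_
  rw [← neg_mul]
  exact aux_mul_le (by rw [abs_neg]; exact aux_abs t1 t2 i)

lemma aux_eq {A : Matrix V V ℝ} (hA : A.IsHermitian) {S : Matrix V V ℝ}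
    (hs : Sᵀ = S) (ho : S * S = 1)
    (he : -trace (S * A) = ∑ i, |hA.eigenvalues i|) {i : V} (hi : S i i ^ 2 = 1)
    (hAi : A i i = 0) (k : V) : A i k = 0 := by
  obtain ⟨U, h1, h2, h3⟩ := aux_spec hA 0
  simp only [zero_smul, sub_zero] at h3
  set l := hA.eigenvalues with hl
  obtain ⟨t1, t2⟩ := aux_conj hs ho h1 h2
  set T := Uᵀ * S * U with hT
  have htr : -trace (S * A) = ∑ j, -T j j * l j := by
    conv_lhs => rw [h3]
    rw [aux_trace, ← Finset.sum_neg_distrib]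
    exact Finset.sum_congr rfl fun j _ => by rw [neg_mul]
  rw [htr] at he
  have hj : ∀ j, -T j j * l j = |l j| := by
    have := (Finset.sum_eq_sum_iff_of_le (s := univ) (f := fun j => -T j j * l j)
      (g := fun j => |l j|)
      (fun j _ => aux_mul_le (by rw [abs_neg]; exact aux_abs t1 t2 j))).1 he
    exact fun j => this j (mem_univ j)
  have hTU : T * Uᵀ = Uᵀ * S := by
    rw [hT, Matrix.mul_assoc, h1, Matrix.mul_one]
  have hent : ∀ a b, A a b = ∑ j, U a j * l j * U b j := by
    intro a b
    conv_lhs => rw [h3]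
    rw [mul_apply]
    simp [mul_diagonal]
  have hkey : ∀ j, -S i i * (U i j * l j * U i j) = |l j| * U i j ^ 2 := by
    intro j
    by_cases hlj : l j = 0
    · simp [hlj]
    have hTj : T j j ^ 2 = 1 := by
      have := aux_mul_eq (hj j) hlj
      rwa [neg_sq] at this
    have e := congrFun (congrFun hTU j) i
    rw [mul_apply, mul_apply, Finset.sum_eq_single j, Finset.sum_eq_single i] at e
    · simp only [transpose_apply] at e
      rw [← hj j]
      linear_combination (-U i j * l j) * e.symm
    · intro b _ hb
      have hS : S b i = S i b := congrFun (congrFun hs i) b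
      rw [hS, aux_off hs ho hi hb, mul_zero]
    · simp
    · intro b _ hb
      rw [aux_off t1 t2 hTj hb, zero_mul]
    · simp
  have hsum : ∑ j, |l j| * U i j ^ 2 = 0 := by
    rw [← Finset.sum_congr rfl fun j _ => hkey j, ← Finset.mul_sum, ← hent, hAi, mul_zero]
  rw [Finset.sum_eq_zero_iff_of_nonneg (fun j _ => by positivity)] at hsum
  rw [hent]
  refine Finset.sum_eq_zero fun j _ => ?_
  have := hsum j (mem_univ j)
  rcases mul_eq_zero.1 this with h | h
  · rw [abs_eq_zero.1 h]; ring
  · rw [pow_eq_zero_iff two_ne_zero |>.1 h]; ring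

/-- **Theorem 1.** For a connected graph `G` with a vertex weight `ω`,
`LE_ω(G) ≤ n·MD_ω(G) + E(G)`, with equality iff `G` is `ω`-regular. -/
theorem wLapEnergy_le_of_connected (G : SimpleGraph V) [DecidableRel G.Adj]
    (hG : G.Connected) (ω : V → ℝ) (hω : ∀ v, 0 < ω v) :
    wLapEnergy G ω ≤ (Fintype.card V : ℝ) * meanDev ω + graphEnergy G ∧
    (wLapEnergy G ω = (Fintype.card V : ℝ) * meanDev ω + graphEnergy G ↔
      ∀ u v : V, ω u = ω v) := by
  have hne : Nonempty V := hG.nonempty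
  have hcard : (Fintype.card V : ℝ) ≠ 0 := by
    exact_mod_cast Fintype.card_ne_zero
  have hMD : (Fintype.card V : ℝ) * meanDev ω = ∑ v, |ω v - avgWeight ω| := by
    rw [meanDev, mul_div_cancel₀ _ hcard]
  rw [hMD]
  set c := avgWeight ω with hc
  have hA := adjMatrix_isHermitian G
  have hL : wLaplacian G ω - c • (1 : Matrix V V ℝ)
      = diagonal (fun v => ω v - c) - G.adjMatrix ℝ := by
    rw [wLaplacian, smul_one_eq_diagonal, ← diagonal_sub]
    abel
  obtain ⟨S, hs, ho, ht⟩ := aux_sign (wLaplacian_isHermitian G ω) c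
  have hLE : wLapEnergy G ω = ∑ v, S v v * (ω v - c) + -trace (S * G.adjMatrix ℝ) := by
    rw [wLapEnergy, ← hc, ← ht, hL, mul_sub, trace_sub, sub_eq_add_neg]
    congr 1
    simp [trace, mul_diagonal]
  have hb1 : ∀ v ∈ univ, S v v * (ω v - c) ≤ |ω v - c| :=
    fun v _ => aux_mul_le (aux_abs hs ho v)
  have hb1s := Finset.sum_le_sum hb1
  have hb2 : -trace (S * G.adjMatrix ℝ) ≤ graphEnergy G := by
    have := aux_upper (adjMatrix_isHermitian G) 0 hs ho
    simpa [graphEnergy] using this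
  have hle : wLapEnergy G ω ≤ ∑ v, |ω v - c| + graphEnergy G := by
    rw [hLE]; exact add_le_add hb1s hb2
  refine ⟨hle, ?_, ?_⟩
  · intro he
    rw [hLE] at he
    have e1 : ∑ v, S v v * (ω v - c) = ∑ v, |ω v - c| := by linarith
    have e2 : -trace (S * G.adjMatrix ℝ) = graphEnergy G := by linarith
    have e1' := (Finset.sum_eq_sum_iff_of_le hb1).1 e1
    by_contra hcon
    push Not at hcon
    obtain ⟨u, v, huv⟩ := hcon
    have : Nontrivial V := ⟨u, v, fun h => huv (by rw [h])⟩
    have : ∃ i, ω i - c ≠ 0 := by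
      by_contra hno
      push Not at hno
      exact huv (by linarith [hno u, hno v])
    obtain ⟨i, hi⟩ := this
    have hS := aux_mul_eq (e1' i (mem_univ i)) hi
    obtain ⟨k, hk⟩ := hG.preconnected.exists_adj_of_nontrivial i
    have := aux_eq (adjMatrix_isHermitian G) hs ho e2 hS (by simp) k
    simp [SimpleGraph.adjMatrix_apply, hk] at this
  · intro hreg
    have hz : ∀ v, ω v - c = 0 := by
      intro v
      rw [hc, avgWeight, Finset.sum_congr rfl fun u _ => hreg u v]
      simp [hcard]
    refine le_antisymm hle ?_
    obtain ⟨R, rs, ro, rt⟩ := aux_sign (adjMatrix_isHermitian G) 0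
    have h := aux_upper (wLaplacian_isHermitian G ω) c rs ro
    rw [hL] at h
    simp only [hz, zero_smul, sub_zero, diagonal_zero, zero_sub, mul_neg, trace_neg, neg_neg] at h rt
    simp only [hz, abs_zero, Finset.sum_const_zero, zero_add]
    rw [rt] at h
    exact h
end

section
/- Let G be a bipartite simple graph on n vertices with a vertex weight ω. Then max{ n·MD_ω(G), E(G) } ≤ LE_ω(G) ≤ n·MD_ω(G) + E(G). -/
open Matrix Finset

set_option linter.unusedSectionVars false

variable {V : Type*} [Fintype V] [DecidableEq V]

lemma aux_decomp {B : Matrix V V ℝ} (hB : B.IsHermitian) (c : ℝ) :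
    B - c • (1 : Matrix V V ℝ) = (hB.eigenvectorUnitary : Matrix V V ℝ) *
      diagonal (fun i => hB.eigenvalues i - c) * star (hB.eigenvectorUnitary : Matrix V V ℝ) := by
  have h := hB.spectral_theorem
  rw [Unitary.conjStarAlgAut_apply] at h
  have h2 : diagonal (fun i => hB.eigenvalues i - c) =
      diagonal (RCLike.ofReal ∘ hB.eigenvalues) - c • (1 : Matrix V V ℝ) := by
    ext i j
    by_cases hij : i = j
    · subst hij; simp
    · simp [hij]
  have h3 : (hB.eigenvectorUnitary : Matrix V V ℝ) * star (hB.eigenvectorUnitary : Matrix V V ℝ)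
      = 1 := Unitary.coe_mul_star_self _
  rw [h2, mul_sub, sub_mul, ← h]
  simp [h3]

lemma aux_le {B : Matrix V V ℝ} (hB : B.IsHermitian) (c : ℝ) {Q : Matrix V V ℝ}
    (hQ : Q ∈ Matrix.unitaryGroup V ℝ) :
    trace (Q * (B - c • (1 : Matrix V V ℝ))) ≤ ∑ i, |hB.eigenvalues i - c| := by
  rw [aux_decomp hB c]
  set U := hB.eigenvectorUnitary
  have hR : star (U : Matrix V V ℝ) * Q * (U : Matrix V V ℝ) ∈ Matrix.unitaryGroup V ℝ :=
    mul_mem (mul_mem (star U).2 hQ) U.2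
  have : trace (Q * ((U : Matrix V V ℝ) * diagonal (fun i => hB.eigenvalues i - c) *
      star (U : Matrix V V ℝ))) =
      trace ((star (U : Matrix V V ℝ) * Q * (U : Matrix V V ℝ)) *
        diagonal (fun i => hB.eigenvalues i - c)) := by
    rw [← mul_assoc, trace_mul_comm]
    simp only [mul_assoc]
  rw [this, trace]
  apply Finset.sum_le_sum
  intro i _
  rw [diag_apply, mul_diagonal]
  have hb := entry_norm_bound_of_unitary hR i i
  rw [Real.norm_eq_abs] at hb
  refine (le_abs_self _).trans ?_
  rw [abs_mul]
  exact mul_le_of_le_one_left (abs_nonneg _) hb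

lemma aux_diag_mem {s : V → ℝ} (hs : ∀ i, s i * s i = 1) :
    diagonal s ∈ Matrix.unitaryGroup V ℝ := by
  rw [Matrix.mem_unitaryGroup_iff, star_eq_conjTranspose, diagonal_conjTranspose,
    diagonal_mul_diagonal]
  simp [hs]

lemma aux_sgn (x : ℝ) : ∃ s : ℝ, s * s = 1 ∧ s * x = |x| := by
  rcases le_total 0 x with h | h
  · exact ⟨1, by simp, by simp [abs_of_nonneg h]⟩
  · exact ⟨-1, by simp, by simp [abs_of_nonpos h]⟩

lemma aux_eq_s2 {B : Matrix V V ℝ} (hB : B.IsHermitian) (c : ℝ) :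
    ∃ Q ∈ Matrix.unitaryGroup V ℝ,
    trace (Q * (B - c • (1 : Matrix V V ℝ))) = ∑ i, |hB.eigenvalues i - c| := by
  choose s hs1 hs2 using fun i => aux_sgn (hB.eigenvalues i - c)
  set U := hB.eigenvectorUnitary with hU
  have h3 : star (U : Matrix V V ℝ) * (U : Matrix V V ℝ) = 1 := Unitary.coe_star_mul_self _
  refine ⟨(U : Matrix V V ℝ) * diagonal s * star (U : Matrix V V ℝ),
    mul_mem (mul_mem U.2 (aux_diag_mem hs1)) (star U).2, ?_⟩
  rw [aux_decomp hB c, ← hU]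
  have : (U : Matrix V V ℝ) * diagonal s * star (U : Matrix V V ℝ) *
      ((U : Matrix V V ℝ) * diagonal (fun i => hB.eigenvalues i - c) *
      star (U : Matrix V V ℝ)) = (U : Matrix V V ℝ) * (diagonal s *
      (star (U : Matrix V V ℝ) * (U : Matrix V V ℝ)) *
      diagonal (fun i => hB.eigenvalues i - c)) * star (U : Matrix V V ℝ) := by
    simp only [mul_assoc]
  rw [this, h3, mul_one, diagonal_mul_diagonal, trace_mul_comm, ← mul_assoc, h3, one_mul,
    trace_diagonal]
  exact Finset.sum_congr rfl fun i _ => hs2 i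

lemma aux_trace_diag (Q : Matrix V V ℝ) (d : V → ℝ) :
    trace (Q * diagonal d) = ∑ i, Q i i * d i := by
  simp [trace, mul_diagonal]

/-- **Theorem 3.** For a bipartite graph `G` with a vertex weight `ω`,
`max(n·MD_ω(G), E(G)) ≤ LE_ω(G) ≤ n·MD_ω(G) + E(G)`. -/
theorem wLapEnergy_bounds_of_bipartite (G : SimpleGraph V) [DecidableRel G.Adj]
    (hG : G.Colorable 2) (ω : V → ℝ) (hω : ∀ v, 0 < ω v) :
    max ((Fintype.card V : ℝ) * meanDev ω) (graphEnergy G) ≤ wLapEnergy G ω ∧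
    wLapEnergy G ω ≤ (Fintype.card V : ℝ) * meanDev ω + graphEnergy G := by
  have hn : (Fintype.card V : ℝ) * meanDev ω = ∑ v, |ω v - avgWeight ω| := by
    unfold meanDev
    rcases isEmpty_or_nonempty V with h | h
    · simp
    · field_simp
  set c := avgWeight ω with hc
  set d : V → ℝ := fun v => ω v - c with hd
  set A := G.adjMatrix ℝ with hA
  have hM : wLaplacian G ω - c • (1 : Matrix V V ℝ) = diagonal d - A := by
    ext i j
    by_cases hij : i = j
    · subst hij; simp [wLaplacian, hd, hA]
    · simp [wLaplacian, hij, hA]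
  have hL : ∀ Q ∈ Matrix.unitaryGroup V ℝ,
      (∑ i, Q i i * d i) - trace (Q * A) ≤ wLapEnergy G ω := by
    intro Q hQ
    have := aux_le (wLaplacian_isHermitian G ω) c hQ
    rw [hM, mul_sub, trace_sub, aux_trace_diag] at this
    exact this
  have hE : ∀ Q ∈ Matrix.unitaryGroup V ℝ, trace (Q * A) ≤ graphEnergy G := by
    intro Q hQ
    have := aux_le (adjMatrix_isHermitian G) 0 hQ
    simpa [graphEnergy] using this
  have hneg : ∀ Q ∈ Matrix.unitaryGroup V ℝ, -Q ∈ Matrix.unitaryGroup V ℝ := by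
    intro Q hQ
    rw [Matrix.mem_unitaryGroup_iff] at hQ ⊢
    simpa using hQ
  rw [hn]
  refine ⟨max_le ?_ ?_, ?_⟩
  · choose s hs1 hs2 using fun i => aux_sgn (d i)
    have h := hL _ (aux_diag_mem hs1)
    have h0 : trace (diagonal s * A) = 0 := by
      rw [trace]
      refine Finset.sum_eq_zero fun i _ => ?_
      rw [diag_apply, diagonal_mul]
      simp [hA]
    rw [h0, sub_zero] at h
    simp only [diagonal_apply_eq, hs2] at h
    exact h
  · obtain ⟨S, hS, hSE⟩ := aux_eq_s2 (adjMatrix_isHermitian G) 0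
    have hSE : trace (S * A) = graphEnergy G := by simpa [graphEnergy] using hSE
    obtain ⟨C⟩ := hG
    let p : V → ℝ := fun v => if C v = 0 then 1 else -1
    have hp : ∀ v, p v * p v = 1 := by
      intro v; by_cases h : C v = 0 <;> simp [p, h]
    have hPA : diagonal p * A * diagonal p = -A := by
      ext i j
      rw [mul_diagonal, diagonal_mul, Matrix.neg_apply, hA, SimpleGraph.adjMatrix_apply]
      by_cases hij : G.Adj i j
      · have hne := C.valid hij
        have : p i * p j = -1 := by
          by_cases h1 : C i = 0 <;> by_cases h2 : C j = 0
          · exact absurd (h1.trans h2.symm) hne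
          · simp [p, h1, h2]
          · simp [p, h1, h2]
          · exfalso; apply hne; ext; omega
        simp [hij, this]
      · simp [hij]
    have hP := aux_diag_mem hp
    have h1 := hL _ (hneg S hS)
    have h2 := hL _ (mul_mem (mul_mem hP hS) hP)
    have h3 : trace (diagonal p * S * diagonal p * A) = - trace (S * A) := by
      have : diagonal p * S * diagonal p * A = diagonal p * (S * (diagonal p * A)) := by
        simp only [mul_assoc]
      rw [this, trace_mul_comm, mul_assoc, hPA, mul_neg, trace_neg]
    have h4 : ∀ i, (diagonal p * S * diagonal p) i i = S i i := by
      intro i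
      rw [mul_diagonal, diagonal_mul, mul_right_comm, hp, one_mul]
    simp only [h4, h3, hSE] at h2
    simp only [Matrix.neg_apply, neg_mul, Finset.sum_neg_distrib, trace_neg, hSE] at h1
    linarith
  · obtain ⟨S, hS, hSE⟩ := aux_eq_s2 (wLaplacian_isHermitian G ω) c
    have hSE : trace (S * (wLaplacian G ω - c • (1 : Matrix V V ℝ))) = wLapEnergy G ω := hSE
    rw [hM, mul_sub, trace_sub, aux_trace_diag] at hSE
    have h1 := hE _ (hneg S hS)
    rw [neg_mul, trace_neg] at h1
    have h2 : ∑ i, S i i * d i ≤ ∑ v, |ω v - c| := by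
      apply Finset.sum_le_sum
      intro i _
      have hb := entry_norm_bound_of_unitary hS i i
      rw [Real.norm_eq_abs] at hb
      refine (le_abs_self _).trans ?_
      rw [abs_mul]
      exact mul_le_of_le_one_left (abs_nonneg _) hb
    linarith
end

section
/- Let G be a connected simple graph on n vertices. Then LE_Tr(G) ≤ n·MD_Tr(G) + E(G), where Tr is the transmission vertex weight. Moreover, equality holds if and only if G is transmission regular. -/
open Matrix Finset

set_option linter.unusedSectionVars false

variable {V : Type*} [Fintype V] [DecidableEq V]

/-- The transmission of a vertex: `Tr(v) = Σ_u d_G(u,v)`. -/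
noncomputable def transmission (G : SimpleGraph V) (v : V) : ℝ :=
  ∑ u, (G.dist u v : ℝ)

lemma spectral_shift (H : Matrix V V ℝ) (hH : H.IsHermitian) (c : ℝ) :
    ∃ U : Matrix V V ℝ, U * Uᵀ = 1 ∧ Uᵀ * U = 1 ∧
      H - c • (1 : Matrix V V ℝ) = U * diagonal (fun i => hH.eigenvalues i - c) * Uᵀ := by
  refine ⟨(hH.eigenvectorUnitary : Matrix V V ℝ), ?_, ?_, ?_⟩
  · have := Unitary.coe_mul_star_self hH.eigenvectorUnitary
    simpa [star_eq_conjTranspose] using this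
  · have := Unitary.coe_star_mul_self hH.eigenvectorUnitary
    simpa [star_eq_conjTranspose] using this
  · have h1 := Unitary.coe_mul_star_self hH.eigenvectorUnitary
    have h2 := hH.spectral_theorem
    rw [Unitary.conjStarAlgAut_apply] at h2
    rw [Unitary.coe_star] at h1
    rw [star_eq_conjTranspose, conjTranspose_eq_transpose_of_trivial] at h1 h2
    have h3 : diagonal (fun i => hH.eigenvalues i - c)
        = diagonal (RCLike.ofReal ∘ hH.eigenvalues) - c • (1 : Matrix V V ℝ) := by
      ext i j
      by_cases h : i = j <;> simp [h, diagonal, one_apply]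
    rw [h3, mul_sub, sub_mul, ← h2]
    simp [h1]

lemma exists_sign (U : Matrix V V ℝ) (l : V → ℝ) (h2 : Uᵀ * U = 1) (h1 : U * Uᵀ = 1) :
    ∃ P : Matrix V V ℝ, Pᵀ = P ∧ P * P = 1 ∧
      trace (P * (U * diagonal l * Uᵀ)) = ∑ i, |l i| := by
  set s : V → ℝ := fun i => if 0 ≤ l i then 1 else -1 with hs
  have hss : diagonal s * diagonal s = 1 := by
    rw [diagonal_mul_diagonal, ← diagonal_one]
    congr 1; ext i; simp only [hs]; split_ifs <;> norm_num
  refine ⟨U * diagonal s * Uᵀ, ?_, ?_, ?_⟩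
  · simp [Matrix.mul_assoc]
  · calc U * diagonal s * Uᵀ * (U * diagonal s * Uᵀ)
        = U * diagonal s * (Uᵀ * U) * diagonal s * Uᵀ := by simp only [Matrix.mul_assoc]
      _ = U * (diagonal s * diagonal s) * Uᵀ := by
        rw [h2]; simp only [Matrix.mul_assoc, Matrix.mul_one]
      _ = 1 := by rw [hss, Matrix.mul_one, h1]
  · have : U * diagonal s * Uᵀ * (U * diagonal l * Uᵀ)
        = U * (diagonal s * diagonal l) * Uᵀ := by
      calc _ = U * diagonal s * (Uᵀ * U) * diagonal l * Uᵀ := by simp only [Matrix.mul_assoc]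
        _ = _ := by rw [h2]; simp only [Matrix.mul_assoc, Matrix.mul_one]
    rw [this, trace_mul_comm, ← Matrix.mul_assoc, h2, Matrix.one_mul, diagonal_mul_diagonal,
      trace_diagonal]
    refine Finset.sum_congr rfl fun i _ => ?_
    simp only [hs]
    split_ifs with h
    · rw [abs_of_nonneg h, one_mul]
    · rw [abs_of_neg (not_le.mp h)]; ring

lemma invol_row (Q : Matrix V V ℝ) (hQ : Qᵀ = Q) (hQQ : Q * Q = 1) (i : V) :
    ∑ j, Q i j ^ 2 = 1 := by
  have h := congrFun (congrFun hQQ i) i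
  rw [mul_apply, one_apply_eq] at h
  rw [← h]
  refine Finset.sum_congr rfl fun j _ => ?_
  have : Q j i = Q i j := by
    conv_lhs => rw [← hQ]
    rfl
  rw [this, sq]

lemma invol_diag_le (Q : Matrix V V ℝ) (hQ : Qᵀ = Q) (hQQ : Q * Q = 1) (i : V) :
    |Q i i| ≤ 1 := by
  have h := invol_row Q hQ hQQ i
  have h' := Finset.single_le_sum (f := fun j => Q i j ^ 2) (fun j _ => sq_nonneg _)
    (Finset.mem_univ i)
  exact (sq_le_one_iff_abs_le_one _).mp (h ▸ h')

lemma invol_mul_le (Q : Matrix V V ℝ) (hQ : Qᵀ = Q) (hQQ : Q * Q = 1) (i : V) (x : ℝ) :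
    Q i i * x ≤ |x| := by
  calc Q i i * x ≤ |Q i i * x| := le_abs_self _
    _ = |Q i i| * |x| := abs_mul _ _
    _ ≤ 1 * |x| := mul_le_mul_of_nonneg_right (invol_diag_le Q hQ hQQ i) (abs_nonneg _)
    _ = |x| := one_mul _

lemma invol_eq (Q : Matrix V V ℝ) (hQ : Qᵀ = Q) (hQQ : Q * Q = 1) (i : V) (x : ℝ)
    (hx : x ≠ 0) (h : Q i i * x = |x|) (j : V) (hj : j ≠ i) : Q i j = 0 := by
  have h1 : Q i i ^ 2 = 1 := by
    have : (Q i i * x) ^ 2 = x ^ 2 := by rw [h, sq_abs]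
    rw [mul_pow] at this
    exact mul_right_cancel₀ (pow_ne_zero 2 hx) (by rw [this, one_mul])
  have hr := invol_row Q hQ hQQ i
  rw [← Finset.add_sum_erase _ _ (Finset.mem_univ i), h1] at hr
  have h0 : ∑ k ∈ Finset.univ.erase i, Q i k ^ 2 = 0 := by linarith
  rw [Finset.sum_eq_zero_iff_of_nonneg (fun _ _ => sq_nonneg _)] at h0
  exact pow_eq_zero_iff (two_ne_zero) |>.mp (h0 j (by simp [hj]))

lemma trace_le (U : Matrix V V ℝ) (l : V → ℝ) (h2 : Uᵀ * U = 1) (h1 : U * Uᵀ = 1)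
    (P : Matrix V V ℝ) (hP : Pᵀ = P) (hPP : P * P = 1) :
    trace (P * (U * diagonal l * Uᵀ)) ≤ ∑ i, |l i| ∧
    (trace (P * (U * diagonal l * Uᵀ)) = ∑ i, |l i| →
      (P * (U * diagonal l * Uᵀ)).PosSemidef) := by
  obtain ⟨Q, hQdef⟩ : ∃ Q, Q = Uᵀ * P * U := ⟨_, rfl⟩
  have hQ : Qᵀ = Q := by rw [hQdef]; simp [hP, Matrix.mul_assoc]
  have hQQ : Q * Q = 1 := by
    calc Q * Q = Uᵀ * P * (U * Uᵀ) * P * U := by rw [hQdef]; simp only [Matrix.mul_assoc]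
      _ = Uᵀ * (P * P) * U := by
        rw [h1]; simp only [Matrix.mul_assoc, Matrix.one_mul]
      _ = 1 := by rw [hPP, Matrix.mul_one, h2]
  have hPU : P * (U * diagonal l * Uᵀ) = U * (Q * diagonal l) * Uᵀ := by
    calc _ = (U * Uᵀ) * P * (U * diagonal l * Uᵀ) := by rw [h1, Matrix.one_mul]
      _ = _ := by rw [hQdef]; simp only [Matrix.mul_assoc]
  have htr : trace (P * (U * diagonal l * Uᵀ)) = ∑ i, Q i i * l i := by
    rw [hPU, trace_mul_comm, ← Matrix.mul_assoc, h2, Matrix.one_mul]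
    simp [trace, mul_diagonal]
  have hle : ∀ i ∈ Finset.univ, Q i i * l i ≤ |l i| := fun i _ => invol_mul_le Q hQ hQQ i _
  rw [htr]
  refine ⟨Finset.sum_le_sum hle, fun heq => ?_⟩
  rw [Finset.sum_eq_sum_iff_of_le hle] at heq
  have hd : Q * diagonal l = diagonal (fun i => |l i|) := by
    ext i j
    rw [mul_diagonal]
    by_cases hij : i = j
    · subst hij; rw [diagonal_apply_eq]; exact heq i (Finset.mem_univ _)
    · rw [diagonal_apply_ne _ hij]
      by_cases hl : l j = 0
      · rw [hl, mul_zero]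
      · have := invol_eq Q hQ hQQ j (l j) hl (heq j (Finset.mem_univ _)) i hij
        have h' : Q i j = Q j i := by
          conv_lhs => rw [← hQ]
          rfl
        rw [h', this, zero_mul]
  rw [hPU, hd]
  have := (PosSemidef.diagonal (n := V) (R := ℝ) (d := fun i => |l i|)
    (fun i => abs_nonneg _)).mul_mul_conjTranspose_same U
  simpa using this

lemma neg_invol (P : Matrix V V ℝ) (hP : Pᵀ = P) (hPP : P * P = 1) :
    (-P)ᵀ = -P ∧ (-P) * (-P) = 1 := by
  refine ⟨by rw [transpose_neg, hP], by rw [neg_mul_neg, hPP]⟩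

lemma wLap_main (G : SimpleGraph V) [DecidableRel G.Adj] (w : V → ℝ) :
    wLapEnergy G w ≤ (∑ v, |w v - avgWeight w|) + graphEnergy G ∧
    (wLapEnergy G w = (∑ v, |w v - avgWeight w|) + graphEnergy G →
      ∀ v, (∃ u, G.Adj v u) → w v = avgWeight w) := by
  obtain ⟨U, hU1, hU2, hU⟩ := spectral_shift _ (wLaplacian_isHermitian G w) (avgWeight w)
  obtain ⟨P, hP, hPP, htr⟩ := exists_sign U (h2 := hU2) (h1 := hU1)
    (l := fun i => (wLaplacian_isHermitian G w).eigenvalues i - avgWeight w)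
  rw [← hU] at htr
  obtain ⟨W, hW1, hW2, hW⟩ := spectral_shift _ (adjMatrix_isHermitian G) 0
  obtain ⟨hN, hNN⟩ := neg_invol P hP hPP
  obtain ⟨hle, hpsd⟩ := trace_le W (fun i => (adjMatrix_isHermitian G).eigenvalues i - 0)
    hW2 hW1 (-P) hN hNN
  rw [← hW] at hle hpsd
  simp only [sub_zero, zero_smul] at hle hpsd
  have hsplit : trace (P * (wLaplacian G w - avgWeight w • (1 : Matrix V V ℝ)))
      = ∑ v, P v v * (w v - avgWeight w) + trace ((-P) * G.adjMatrix ℝ) := by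
    have e : wLaplacian G w - avgWeight w • (1 : Matrix V V ℝ)
        = diagonal (fun v => w v - avgWeight w) - G.adjMatrix ℝ := by
      ext i j
      by_cases h : i = j
      · subst h; simp [wLaplacian]
      · simp [wLaplacian, h]
    rw [e, mul_sub, trace_sub, neg_mul, trace_neg, ← sub_eq_add_neg]
    congr 1
    simp [trace, mul_diagonal]
  have hdle : ∀ v ∈ Finset.univ, P v v * (w v - avgWeight w) ≤ |w v - avgWeight w| :=
    fun v _ => invol_mul_le P hP hPP v _
  have hdsum := Finset.sum_le_sum hdle
  rw [hsplit] at htr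
  unfold wLapEnergy graphEnergy
  rw [← htr]
  refine ⟨add_le_add hdsum hle, fun heq v hv => ?_⟩
  by_contra hne
  have hd : w v - avgWeight w ≠ 0 := sub_ne_zero.mpr hne
  have e1 := hpsd (by linarith)
  have e2 := (Finset.sum_eq_sum_iff_of_le hdle).mp (by linarith) v (Finset.mem_univ v)
  have hrow := invol_eq P hP hPP v _ hd e2
  have hz : ((-P) * G.adjMatrix ℝ) v v = 0 := by
    rw [mul_apply]
    refine Finset.sum_eq_zero fun j _ => ?_
    by_cases hj : j = v
    · subst hj; simp
    · simp [hrow j hj]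
  have hz2 : ((-P) * G.adjMatrix ℝ) *ᵥ (Pi.single v 1) = 0 := by
    rw [← e1.dotProduct_mulVec_zero_iff]
    simpa [mulVec_single_one] using hz
  have hz3 : G.adjMatrix ℝ *ᵥ (Pi.single v 1) = 0 := by
    have := congrArg (fun x => (-P) *ᵥ x) hz2
    simpa only [mulVec_mulVec, ← Matrix.mul_assoc, hNN, Matrix.one_mul, mulVec_zero] using this
  obtain ⟨u, hu⟩ := hv
  have := congrFun hz3 u
  simp [mulVec_single_one, hu.symm] at this

lemma wLap_const (G : SimpleGraph V) [DecidableRel G.Adj] (w : V → ℝ)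
    (hw : ∀ v, w v = avgWeight w) : graphEnergy G ≤ wLapEnergy G w := by
  obtain ⟨U, hU1, hU2, hU⟩ := spectral_shift _ (wLaplacian_isHermitian G w) (avgWeight w)
  obtain ⟨W, hW1, hW2, hW⟩ := spectral_shift _ (adjMatrix_isHermitian G) 0
  obtain ⟨P, hP, hPP, htr⟩ := exists_sign W (h2 := hW2) (h1 := hW1)
    (l := fun i => (adjMatrix_isHermitian G).eigenvalues i - 0)
  obtain ⟨hN, hNN⟩ := neg_invol P hP hPP
  have hle := (trace_le U (fun i => (wLaplacian_isHermitian G w).eigenvalues i - avgWeight w)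
    hU2 hU1 (-P) hN hNN).1
  rw [← hU] at hle
  rw [← hW] at htr
  simp only [sub_zero, zero_smul] at htr
  have e : wLaplacian G w - avgWeight w • (1 : Matrix V V ℝ) = - G.adjMatrix ℝ := by
    ext i j
    by_cases h : i = j
    · subst h; simp [wLaplacian, ← hw i]
    · simp [wLaplacian, h]
  rw [e, neg_mul_neg, htr] at hle
  exact hle

theorem wLapEnergy_transmission_le (G : SimpleGraph V) [DecidableRel G.Adj]
    (hG : G.Connected) :
    wLapEnergy G (transmission G) ≤ (Fintype.card V : ℝ) * meanDev (transmission G) + graphEnergy G ∧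
    (wLapEnergy G (transmission G) = (Fintype.card V : ℝ) * meanDev (transmission G) + graphEnergy G ↔
      ∀ u v : V, transmission G u = transmission G v) := by
  have hne : Nonempty V := hG.nonempty
  have hc : (Fintype.card V : ℝ) ≠ 0 := by exact_mod_cast Fintype.card_ne_zero
  have hmd : (Fintype.card V : ℝ) * meanDev (transmission G)
      = ∑ v, |transmission G v - avgWeight (transmission G)| := by
    unfold meanDev
    field_simp
  rw [hmd]
  obtain ⟨h1, h2⟩ := wLap_main G (transmission G)
  refine ⟨h1, fun h u v => ?_, fun h => ?_⟩
  · rcases subsingleton_or_nontrivial V with hs | hs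
    · rw [Subsingleton.elim u v]
    · have key : ∀ v, transmission G v = avgWeight (transmission G) := fun v =>
        h2 h v (hG.preconnected.exists_adj_of_nontrivial v)
      rw [key u, key v]
  · have hw : ∀ v, transmission G v = avgWeight (transmission G) := by
      intro v
      have : ∑ u, transmission G u = ∑ _u : V, transmission G v :=
        Finset.sum_congr rfl fun u _ => h u v
      unfold avgWeight
      rw [this, Finset.sum_const, Finset.card_univ, nsmul_eq_mul]
      field_simp
    have h0 : ∑ v, |transmission G v - avgWeight (transmission G)| = 0 :=
      Finset.sum_eq_zero fun v _ => by rw [hw v, sub_self, abs_zero]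
    refine le_antisymm h1 ?_
    rw [h0, zero_add]
    exact wLap_const G _ hw
end

section
/- Let G be a connected bipartite simple graph on n vertices. Then max{ n·MD_Tr(G), E(G) } ≤ LE_Tr(G) ≤ n·MD_Tr(G) + E(G), where Tr is the transmission vertex weight. -/
open Matrix Finset

set_option linter.unusedSectionVars false

variable {V : Type*} [Fintype V] [DecidableEq V]

/-- `s` is the sum of the absolute values of the spectrum of `M`. -/
def IsTN (M : Matrix V V ℝ) (s : ℝ) : Prop :=
  ∃ U ∈ Matrix.unitaryGroup V ℝ, ∃ d : V → ℝ, M = U * diagonal d * star U ∧ s = ∑ i, |d i|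

lemma isTN_le {M : Matrix V V ℝ} {s : ℝ} (h : IsTN M s) (W : Matrix V V ℝ)
    (hW : W ∈ Matrix.unitaryGroup V ℝ) : (M * W).trace ≤ s := by
  obtain ⟨U, hU, d, rfl, rfl⟩ := h
  have hmem : star U * W * U ∈ Matrix.unitaryGroup V ℝ :=
    mul_mem (mul_mem (Unitary.star_mem hU) hW) hU
  have e : (U * diagonal d * star U * W).trace = (diagonal d * (star U * W * U)).trace := by
    rw [Matrix.mul_assoc, Matrix.mul_assoc, Matrix.trace_mul_comm U]
    simp only [Matrix.mul_assoc]
  rw [e, Matrix.trace]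
  refine Finset.sum_le_sum fun i _ => ?_
  have hb := entry_norm_bound_of_unitary hmem i i
  rw [Matrix.diag_apply, Matrix.diagonal_mul]
  refine (le_abs_self _).trans ?_
  rw [abs_mul]
  rw [Real.norm_eq_abs] at hb
  exact mul_le_of_le_one_right (abs_nonneg _) hb

lemma diag_unitary (d : V → ℝ) (h : ∀ i, d i * d i = 1) :
    diagonal d ∈ Matrix.unitaryGroup V ℝ := by
  rw [Matrix.mem_unitaryGroup_iff, Matrix.star_eq_conjTranspose, Matrix.diagonal_conjTranspose,
    Matrix.diagonal_mul_diagonal]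
  simp [h]

lemma isTN_attain {M : Matrix V V ℝ} {s : ℝ} (h : IsTN M s) :
    ∃ W ∈ Matrix.unitaryGroup V ℝ, (M * W).trace = s := by
  obtain ⟨U, hU, d, rfl, rfl⟩ := h
  let e : V → ℝ := fun i => if 0 ≤ d i then 1 else -1
  have he : diagonal e ∈ Matrix.unitaryGroup V ℝ := by
    apply diag_unitary
    intro i
    simp only [e]
    split_ifs <;> norm_num
  refine ⟨U * diagonal e * star U, mul_mem (mul_mem hU he) (Unitary.star_mem hU), ?_⟩
  have h1 : star U * U = 1 := Matrix.mem_unitaryGroup_iff'.1 hU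
  have : U * diagonal d * star U * (U * diagonal e * star U)
      = U * (diagonal d * diagonal e * star U) := by
    calc _ = U * diagonal d * (star U * U) * diagonal e * star U := by
            simp only [Matrix.mul_assoc]
      _ = _ := by rw [h1]; simp only [Matrix.mul_assoc, Matrix.mul_one]
  rw [this, Matrix.trace_mul_comm, Matrix.mul_assoc, h1, Matrix.mul_one,
    Matrix.diagonal_mul_diagonal, Matrix.trace_diagonal]
  refine Finset.sum_congr rfl fun i _ => ?_
  simp only [e]
  split_ifs with hi
  · rw [abs_of_nonneg hi, mul_one]
  · rw [abs_of_neg (not_le.1 hi)]; ring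

lemma isTN_triangle {M N : Matrix V V ℝ} {s t r : ℝ} (hM : IsTN M s) (hN : IsTN N t)
    (h : IsTN (M + N) r) : r ≤ s + t := by
  obtain ⟨W, hW, rfl⟩ := isTN_attain h
  rw [Matrix.add_mul, Matrix.trace_add]
  exact add_le_add (isTN_le hM W hW) (isTN_le hN W hW)

lemma isTN_smul {M : Matrix V V ℝ} {s : ℝ} (c : ℝ) (h : IsTN M s) : IsTN (c • M) (|c| * s) := by
  obtain ⟨U, hU, d, rfl, rfl⟩ := h
  refine ⟨U, hU, c • d, ?_, ?_⟩
  · rw [Matrix.diagonal_smul, Matrix.mul_smul, Matrix.smul_mul]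
  · simp [Finset.mul_sum, abs_mul]

lemma isTN_conj {M : Matrix V V ℝ} {s : ℝ} {S : Matrix V V ℝ} (hS : S ∈ Matrix.unitaryGroup V ℝ)
    (h : IsTN M s) : IsTN (S * M * star S) s := by
  obtain ⟨U, hU, d, rfl, rfl⟩ := h
  refine ⟨S * U, mul_mem hS hU, d, ?_, rfl⟩
  simp only [star_mul, Matrix.mul_assoc]

lemma isTN_diagonal (d : V → ℝ) : IsTN (diagonal d) (∑ i, |d i|) :=
  ⟨1, one_mem _, d, by simp, rfl⟩

lemma isTN_herm {M : Matrix V V ℝ} (hM : M.IsHermitian) (c : ℝ) :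
    IsTN (M - diagonal fun _ => c) (∑ i, |hM.eigenvalues i - c|) := by
  refine ⟨hM.eigenvectorUnitary, hM.eigenvectorUnitary.2, fun i => hM.eigenvalues i - c, ?_, rfl⟩
  have h1 := Matrix.mem_unitaryGroup_iff.1 hM.eigenvectorUnitary.2
  have h2 := hM.spectral_theorem
  rw [Unitary.conjStarAlgAut_apply] at h2
  have h3 : (diagonal fun i => hM.eigenvalues i - c)
      = diagonal (RCLike.ofReal ∘ hM.eigenvalues) - c • (1 : Matrix V V ℝ) := by
    rw [← Matrix.diagonal_one, ← Matrix.diagonal_smul, Matrix.diagonal_sub]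
    congr 1
    ext i
    simp
  have h4 : (diagonal fun _ => c) = c • (1 : Matrix V V ℝ) := by
    rw [← Matrix.diagonal_one, ← Matrix.diagonal_smul]
    congr 1
    ext i
    simp
  rw [h3, Matrix.mul_sub, Matrix.sub_mul, h4]
  congr 1
  rw [Matrix.mul_smul, Matrix.mul_one, Matrix.smul_mul, h1]

theorem wLapEnergy_transmission_bounds (G : SimpleGraph V) [DecidableRel G.Adj]
    (hG : G.Connected) (hb : G.Colorable 2) :
    max ((Fintype.card V : ℝ) * meanDev (transmission G)) (graphEnergy G) ≤ wLapEnergy G (transmission G) ∧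
    wLapEnergy G (transmission G) ≤ (Fintype.card V : ℝ) * meanDev (transmission G) + graphEnergy G := by
  have hne := hG.nonempty
  have hcard : (Fintype.card V : ℝ) ≠ 0 := by
    exact_mod_cast Fintype.card_ne_zero
  set w := transmission G with hw
  have hMD : (Fintype.card V : ℝ) * meanDev w = ∑ v, |w v - avgWeight w| := by
    unfold meanDev
    field_simp
  rw [hMD]
  have hD := isTN_diagonal (fun v => w v - avgWeight w)
  have hA : IsTN (G.adjMatrix ℝ) (graphEnergy G) := by
    have := isTN_herm (adjMatrix_isHermitian G) 0
    simpa [graphEnergy] using this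
  set D : Matrix V V ℝ := diagonal (fun v => w v - avgWeight w) with hDdef
  have hL : IsTN (D - G.adjMatrix ℝ) (wLapEnergy G w) := by
    have := isTN_herm (wLaplacian_isHermitian G w) (avgWeight w)
    have e : wLaplacian G w - (diagonal fun _ => avgWeight w) = D - G.adjMatrix ℝ := by
      rw [wLaplacian, hDdef, ← Matrix.diagonal_sub]
      abel
    rw [e] at this
    exact this
  obtain ⟨C⟩ := hb
  let e : V → ℝ := fun v => if C v = 0 then 1 else -1
  have hS := diag_unitary e (by intro i; simp only [e]; split_ifs <;> norm_num)
  have hL' : IsTN (D + G.adjMatrix ℝ) (wLapEnergy G w) := by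
    have := isTN_conj hS hL
    convert this using 1
    rw [Matrix.star_eq_conjTranspose, Matrix.diagonal_conjTranspose]
    ext i j
    rw [Matrix.mul_diagonal, Matrix.diagonal_mul]
    by_cases hij : i = j
    · subst hij
      simp only [e, hDdef, Matrix.add_apply, Matrix.sub_apply, SimpleGraph.adjMatrix_apply]
      simp
      split_ifs <;> simp
    · simp only [hDdef, Matrix.add_apply, Matrix.sub_apply, SimpleGraph.adjMatrix_apply,
        Matrix.diagonal_apply_ne _ hij]
      by_cases ha : G.Adj i j
      · have hc := C.valid ha
        have : ∀ a b : Fin 2, a ≠ b → ((a = 0 ∧ b ≠ 0) ∨ (a ≠ 0 ∧ b = 0)) := by decide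
        rcases this _ _ hc with ⟨h1, h2⟩ | ⟨h1, h2⟩ <;> simp [e, ha, h1, h2]
      · simp [ha]
  refine ⟨max_le ?_ ?_, ?_⟩
  · have h2 := isTN_smul 2 hD
    have e2 : (2 : ℝ) • D = (D - G.adjMatrix ℝ) + (D + G.adjMatrix ℝ) := by
      rw [two_smul]; abel
    rw [e2] at h2
    have := isTN_triangle hL hL' h2
    rw [abs_two] at this
    linarith
  · have h2 := isTN_smul 2 hA
    have e2 : (2 : ℝ) • G.adjMatrix ℝ = (D + G.adjMatrix ℝ) + (-1 : ℝ) • (D - G.adjMatrix ℝ) := by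
      rw [two_smul, neg_one_smul]; abel
    rw [e2] at h2
    have := isTN_triangle hL' (isTN_smul (-1) hL) h2
    rw [abs_two, abs_neg, abs_one] at this
    linarith
  · have h1 := isTN_smul (-1) hA
    rw [sub_eq_add_neg, ← neg_one_smul ℝ] at hL
    have := isTN_triangle hD h1 hL
    rw [abs_neg, abs_one] at this
    linarith
end

section
/- Let G be a connected simple graph on n vertices. Then LE_{deg²}(G) ≤ n·MD_{deg²}(G) + E(G), where deg² is the squared vertex degree weight. Moreover, equality holds if and only if G is vertex degree regular. -/
open Matrix Finset

set_option linter.unusedSectionVars false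

variable {V : Type*} [Fintype V] [DecidableEq V]

/-- The squared-degree vertex weight `deg²(u) = deg_G(u)²`. -/
def degSq (G : SimpleGraph V) [DecidableRel G.Adj] (u : V) : ℝ :=
  (G.degree u : ℝ) ^ 2

/-- polar-type decomposition of a symmetric matrix -/
def IsPol (A S R : Matrix V V ℝ) : Prop :=
  Sᵀ = S ∧ S * S = 1 ∧ Rᵀ = R ∧ A = S * (R * R)

lemma isPol_diag (d : V → ℝ) :
    IsPol (diagonal d) (diagonal fun i => if 0 ≤ d i then 1 else -1)
      (diagonal fun i => Real.sqrt |d i|) := by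
  refine ⟨by simp, ?_, by simp, ?_⟩
  · rw [diagonal_mul_diagonal, ← diagonal_one]
    congr 1; ext i; split_ifs <;> simp
  · rw [diagonal_mul_diagonal, diagonal_mul_diagonal]
    congr 1; ext i
    rw [Real.mul_self_sqrt (abs_nonneg _)]
    split_ifs with h
    · simp [abs_of_nonneg h]
    · simp [abs_of_neg (not_le.mp h)]

lemma exists_isPol (A U : Matrix V V ℝ) (d : V → ℝ)
    (hU : Uᵀ * U = 1) (hA : A = U * diagonal d * Uᵀ) :
    ∃ S R, IsPol A S R ∧ (R * R).trace = ∑ i, |d i| := by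
  obtain ⟨h1, h2, h3, h4⟩ := isPol_diag d
  set S := diagonal (fun i => if 0 ≤ d i then (1:ℝ) else -1)
  have hR2 : (diagonal fun i => Real.sqrt |d i|) * (diagonal fun i => Real.sqrt |d i|)
      = diagonal fun i => |d i| := by
    rw [diagonal_mul_diagonal]
    congr 1; ext i
    rw [Real.mul_self_sqrt (abs_nonneg _)]
  set R := diagonal (fun i => Real.sqrt |d i|)
  have hU' : U * Uᵀ = 1 := mul_eq_one_comm.mp hU
  have key : ∀ X Y : Matrix V V ℝ, (U * X * Uᵀ) * (U * Y * Uᵀ) = U * (X * Y) * Uᵀ := by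
    intro X Y
    calc _ = U * X * (Uᵀ * U) * Y * Uᵀ := by simp only [Matrix.mul_assoc]
      _ = _ := by rw [hU]; simp only [Matrix.mul_assoc, Matrix.one_mul]
  refine ⟨U * S * Uᵀ, U * R * Uᵀ, ⟨?_, ?_, ?_, ?_⟩, ?_⟩
  · simp [transpose_mul, h1, Matrix.mul_assoc]
  · rw [key, h2, Matrix.mul_one, hU']
  · simp [transpose_mul, h3, Matrix.mul_assoc]
  · rw [key, key, ← h4, hA]
  · rw [key, trace_mul_comm, ← Matrix.mul_assoc, hU, Matrix.one_mul, hR2, trace_diagonal]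

lemma pol_bound {A S R T : Matrix V V ℝ}
    (h : IsPol A S R) (hT : Tᵀ * T = 1) :
    (T * A).trace ≤ (R * R).trace ∧ ((T * A).trace = (R * R).trace → T * A = R * R) := by
  obtain ⟨h1, h2, h3, h4⟩ := h
  obtain ⟨Q, hQ⟩ : ∃ Q, Q = T * S := ⟨_, rfl⟩
  have hQQ : Qᵀ * Q = 1 := by
    rw [hQ, transpose_mul, h1]
    calc _ = S * (Tᵀ * T) * S := by simp only [Matrix.mul_assoc]
      _ = 1 := by rw [hT, Matrix.mul_one, h2]
  have hTA : T * A = Q * (R * R) := by rw [h4, hQ, Matrix.mul_assoc]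
  have hX : (((Q - 1) * R)ᵀ * ((Q - 1) * R)).trace = 2 * (R * R).trace - 2 * (T * A).trace := by
    have e : ((Q - 1) * R)ᵀ * ((Q - 1) * R)
        = R * (Qᵀ * Q) * R - R * Qᵀ * R - R * Q * R + R * R := by
      rw [transpose_mul, h3, transpose_sub, transpose_one]
      noncomm_ring
    have e1 : (R * Q * R).trace = (Q * (R * R)).trace := by
      rw [Matrix.mul_assoc, trace_mul_comm, Matrix.mul_assoc]
    have e2 : (R * Qᵀ * R).trace = (R * Q * R).trace := by
      rw [← trace_transpose]; simp [transpose_mul, h3, Matrix.mul_assoc]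
    rw [e, hQQ, Matrix.mul_one, trace_add, trace_sub, trace_sub, e2, e1, hTA]
    ring
  have hsum : (((Q - 1) * R)ᵀ * ((Q - 1) * R)).trace = ∑ i, ∑ j, ((Q - 1) * R) j i ^ 2 := by
    generalize (Q - 1) * R = M
    simp [trace, Matrix.mul_apply, sq]
  have hnn : 0 ≤ ∑ i, ∑ j, ((Q - 1) * R) j i ^ 2 :=
    sum_nonneg fun i _ => sum_nonneg fun j _ => sq_nonneg _
  refine ⟨by linarith, fun he => ?_⟩
  have h0 : ∑ i, ∑ j, ((Q - 1) * R) j i ^ 2 = 0 := by linarith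
  have hz : (Q - 1) * R = 0 := by
    ext j i
    rw [sum_eq_zero_iff_of_nonneg fun i _ => sum_nonneg fun j _ => sq_nonneg _] at h0
    have := h0 i (mem_univ _)
    rw [sum_eq_zero_iff_of_nonneg fun j _ => sq_nonneg _] at this
    simpa using this j (mem_univ _)
  have : Q * R = R := by
    rw [Matrix.sub_mul, Matrix.one_mul] at hz
    exact sub_eq_zero.mp hz
  rw [hTA, ← Matrix.mul_assoc, this]

lemma herm_pol {A : Matrix V V ℝ} (hA : A.IsHermitian)
    (c : ℝ) : ∃ S R, IsPol (A - c • (1 : Matrix V V ℝ)) S R ∧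
      (R * R).trace = ∑ i, |hA.eigenvalues i - c| := by
  have hU : ((hA.eigenvectorUnitary : Matrix V V ℝ))ᵀ * (hA.eigenvectorUnitary : Matrix V V ℝ) = 1 := by
    have := Unitary.coe_star_mul_self hA.eigenvectorUnitary
    simpa [star_eq_conjTranspose, conjTranspose_eq_transpose_of_trivial] using this
  refine exists_isPol _ (hA.eigenvectorUnitary : Matrix V V ℝ) _ hU ?_
  have hs := hA.spectral_theorem
  rw [Unitary.conjStarAlgAut_apply] at hs
  have hU' := mul_eq_one_comm.mp hU
  have hd : diagonal (fun i => hA.eigenvalues i - c)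
      = diagonal (hA.eigenvalues) - c • (1 : Matrix V V ℝ) := by
    ext i j; by_cases h : i = j <;> simp [h, diagonal_apply, Matrix.one_apply]
  rw [hd, Matrix.mul_sub, Matrix.sub_mul, Matrix.mul_smul, Matrix.mul_one, Matrix.smul_mul, hU']
  rw [sub_left_inj]
  simpa [star_eq_conjTranspose, conjTranspose_eq_transpose_of_trivial, Function.comp_def] using hs

theorem wLapEnergy_degSq_le (G : SimpleGraph V) [DecidableRel G.Adj]
    (hG : G.Connected) :
    wLapEnergy G (degSq G) ≤ (Fintype.card V : ℝ) * meanDev (degSq G) + graphEnergy G ∧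
    (wLapEnergy G (degSq G) = (Fintype.card V : ℝ) * meanDev (degSq G) + graphEnergy G ↔
      ∀ u v : V, G.degree u = G.degree v) := by
  have : Nonempty V := hG.nonempty
  have hc : (Fintype.card V : ℝ) ≠ 0 := by simp
  set w := degSq G with hw
  set c := avgWeight w with hcdef
  have hMD : (Fintype.card V : ℝ) * meanDev w = ∑ v, |w v - c| := by
    unfold meanDev; field_simp; rfl
  obtain ⟨SB, RB, hB, hBt⟩ := herm_pol (wLaplacian_isHermitian G w) c
  obtain ⟨SA, RA, hA, hAt⟩ := herm_pol (adjMatrix_isHermitian G) 0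
  have hLE : wLapEnergy G w = (RB * RB).trace := by rw [hBt]; rfl
  have hE : graphEnergy G = (RA * RA).trace := by rw [hAt]; simp [graphEnergy]
  rw [zero_smul, sub_zero] at hA
  have hBeq : wLaplacian G w - c • (1 : Matrix V V ℝ)
      = diagonal (fun i => w i - c) - G.adjMatrix ℝ := by
    unfold wLaplacian
    ext i j; by_cases h : i = j <;> simp [h, diagonal_apply, Matrix.one_apply]
  rw [hBeq] at hB
  set A := G.adjMatrix ℝ with hAdef
  set d : V → ℝ := fun i => w i - c with hd
  have hD := isPol_diag d
  have hDt : (diagonal (fun i => Real.sqrt |d i|) * diagonal (fun i => Real.sqrt |d i|))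
      = diagonal (fun i => |d i|) := by
    rw [diagonal_mul_diagonal]
    congr 1; ext i
    rw [Real.mul_self_sqrt (abs_nonneg _)]
  have hSB : SBᵀ * SB = 1 := by rw [hB.1, hB.2.1]
  have hSB' : (-SB)ᵀ * (-SB) = 1 := by rw [transpose_neg, neg_mul_neg, hSB]
  obtain ⟨d1, d2⟩ := pol_bound hD hSB
  obtain ⟨a1, a2⟩ := pol_bound hA hSB'
  rw [hDt] at d1 d2
  rw [trace_diagonal] at d1 d2
  have hBtr : (RB * RB).trace = (SB * diagonal d).trace + (-SB * A).trace := by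
    have : RB * RB = SB * (diagonal d - A) := by
      rw [hB.2.2.2, ← Matrix.mul_assoc, hB.2.1, Matrix.one_mul]
    rw [this, ← trace_add, Matrix.mul_sub, Matrix.neg_mul, sub_eq_add_neg]
  rw [hMD, hLE, hE]
  have hle : (RB * RB).trace ≤ ∑ v, |w v - c| + (RA * RA).trace := by
    rw [hBtr]; exact add_le_add d1 a1
  refine ⟨hle, fun he => ?_, fun hreg => ?_⟩
  · have hd1 : (SB * diagonal d).trace = ∑ i, |d i| := by
      apply le_antisymm d1
      have : ∑ i, |d i| = ∑ v, |w v - c| := rfl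
      linarith
    have ha1 : (-SB * A).trace = (RA * RA).trace := by
      apply le_antisymm a1
      have : ∑ i, |d i| = ∑ v, |w v - c| := rfl
      linarith
    have d3 := d2 hd1
    have a3 := a2 ha1
    have hzero : ∀ i, d i = 0 := by
      intro i
      by_contra hi
      have hS : ∀ j, j ≠ i → SB i j = 0 := by
        intro j hj
        have := congrFun (congrFun d3 j) i
        rw [mul_diagonal, diagonal_apply_ne _ hj] at this
        have h2 : SB j i = 0 := (mul_eq_zero.mp this).resolve_right hi
        rw [← hB.1]; exact h2
      have hii : (RA * RA) i i = 0 := by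
        rw [← a3, Matrix.mul_apply]
        refine sum_eq_zero fun j _ => ?_
        by_cases hj : j = i
        · subst hj; simp [hAdef]
        · simp [hS j hj]
      have hR : ∀ j, RA j i = 0 := by
        have h2 : ∑ j, RA j i ^ 2 = 0 := by
          rw [← hii, Matrix.mul_apply]
          refine sum_congr rfl fun j _ => ?_
          have : RA i j = RA j i := congrFun (congrFun hA.2.2.1 j) i
          rw [this, sq]
        rw [sum_eq_zero_iff_of_nonneg fun j _ => sq_nonneg _] at h2
        intro j
        simpa using h2 j (mem_univ _)
      have hAi : ∀ k, ¬ G.Adj k i := by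
        intro k hk
        have h1 : A k i = 1 := by simp [hAdef, hk]
        have h2 : A k i = 0 := by
          rw [hA.2.2.2, ← Matrix.mul_assoc, Matrix.mul_apply]
          exact sum_eq_zero fun j _ => by rw [hR j, mul_zero]
        linarith
      have huniq : ∀ k, k = i := by
        intro k
        by_contra hk
        have : Nontrivial V := ⟨k, i, hk⟩
        obtain ⟨m, hm⟩ := hG.preconnected.exists_adj_of_nontrivial i
        exact hAi m hm.symm
      apply hi
      have hu : (univ : Finset V) = {i} := by ext k; simp [huniq k]
      have hcard : Fintype.card V = 1 := by rw [← card_univ, hu, card_singleton]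
      simp [hd, hcdef, avgWeight, hu, hcard]
    intro u v
    have hu := hzero u
    have hv := hzero v
    simp only [hd, hw, degSq] at hu hv
    have : (G.degree u : ℝ) ^ 2 = (G.degree v : ℝ) ^ 2 := by linarith
    have := (sq_eq_sq₀ (Nat.cast_nonneg _) (Nat.cast_nonneg _)).mp this
    exact_mod_cast this
  · have hzero : ∀ i, d i = 0 := by
      intro i
      have : ∀ v, w v = w i := fun v => by simp only [hw, degSq, hreg v i]
      simp only [hd, hcdef, avgWeight]
      rw [sum_congr rfl fun v _ => this v]
      simp
    apply le_antisymm hle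
    have h0 : ∑ v, |w v - c| = 0 := sum_eq_zero fun v _ => by
      have := hzero v
      simp only [hd] at this
      rw [this, abs_zero]
    rw [h0, zero_add]
    have hdd : diagonal d = 0 := by
      rw [← diagonal_zero]; congr 1; ext i; exact hzero i
    have hSA : (-SA)ᵀ * (-SA) = 1 := by rw [transpose_neg, neg_mul_neg, hA.1, hA.2.1]
    have hb := (pol_bound hB hSA).1
    rw [hdd, zero_sub, neg_mul_neg] at hb
    have : SA * A = RA * RA := by
      conv_lhs => rw [hA.2.2.2]
      rw [← Matrix.mul_assoc, hA.2.1, Matrix.one_mul]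
    rwa [this] at hb
end

section
/- Let G be a bipartite simple graph. Then LE_{deg²}(G) ≥ E(G), where deg² is the squared vertex degree weight. Moreover, equality holds if and only if G is vertex degree regular. -/
open Matrix Finset

set_option linter.unusedSectionVars false

variable {V : Type*} [Fintype V] [DecidableEq V]

def Contr (U : Matrix V V ℝ) : Prop := ∀ x : V → ℝ, (U *ᵥ x) ⬝ᵥ (U *ᵥ x) ≤ x ⬝ᵥ x

lemma Contr.mul {U W : Matrix V V ℝ} (hU : Contr U) (hW : Contr W) : Contr (U * W) := by
  intro x
  rw [← Matrix.mulVec_mulVec]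
  exact (hU _).trans (hW x)

lemma Contr.neg {U : Matrix V V ℝ} (hU : Contr U) : Contr (-U) := by
  intro x
  simpa [Matrix.neg_mulVec] using hU x

lemma contr_orth {E : Matrix V V ℝ} (hE : Eᵀ * E = 1) : Contr E := by
  intro x
  rw [Matrix.dotProduct_mulVec, ← Matrix.mulVec_transpose, Matrix.mulVec_mulVec, hE,
    Matrix.one_mulVec]

lemma contr_diag {s : V → ℝ} (hs : ∀ i, s i ^ 2 ≤ 1) : Contr (Matrix.diagonal s) := by
  intro x
  simp only [dotProduct, Matrix.mulVec_diagonal]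
  apply Finset.sum_le_sum
  intro i _
  nlinarith [hs i, sq_nonneg (x i)]

lemma Contr.col {K : Matrix V V ℝ} (hK : Contr K) (j : V) : ∑ i, K i j ^ 2 ≤ 1 := by
  have h := hK (Pi.single j 1)
  simp only [Matrix.mulVec_single_one] at h
  simpa [dotProduct, pow_two, Matrix.col, Pi.single_apply] using h

lemma Contr.diag_sq {K : Matrix V V ℝ} (hK : Contr K) (j : V) : K j j ^ 2 ≤ 1 :=
  (Finset.single_le_sum (f := fun i => K i j ^ 2) (fun i _ => sq_nonneg _)
    (Finset.mem_univ j)).trans (hK.col j)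

lemma Contr.off {K : Matrix V V ℝ} (hK : Contr K) {i j : V} (hij : i ≠ j)
    (h1 : K j j ^ 2 = 1) : K i j = 0 := by
  have h := hK.col j
  have h2 : ∑ k ∈ ({i, j} : Finset V), K k j ^ 2 ≤ ∑ k, K k j ^ 2 :=
    Finset.sum_le_sum_of_subset_of_nonneg (Finset.subset_univ _) (fun _ _ _ => sq_nonneg _)
  rw [Finset.sum_pair hij] at h2
  have : K i j ^ 2 ≤ 0 := by linarith
  exact pow_eq_zero_iff (two_ne_zero) |>.1 (le_antisymm this (sq_nonneg _))

lemma Contr.entry {U : Matrix V V ℝ} (hU : Contr U) (B : Matrix V V ℝ) (v : V) :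
    ((U * B) v v) ^ 2 ≤ ∑ w, B w v ^ 2 := by
  have h := hU (fun w => B w v)
  have h2 : ((U *ᵥ (fun w => B w v)) v) ^ 2 ≤
      (U *ᵥ (fun w => B w v)) ⬝ᵥ (U *ᵥ (fun w => B w v)) := by
    simp only [dotProduct, ← pow_two]
    exact Finset.single_le_sum (f := fun i => (U *ᵥ (fun w => B w v)) i ^ 2)
      (fun i _ => sq_nonneg _) (Finset.mem_univ v)
  have h3 : (U * B) v v = (U *ᵥ (fun w => B w v)) v := by
    simp [Matrix.mul_apply, Matrix.mulVec, dotProduct]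
  rw [h3]
  refine (h2.trans h).trans (le_of_eq ?_)
  simp [dotProduct, pow_two]

lemma conj_diag_entry (E : Matrix V V ℝ) (ν : V → ℝ) (v : V) :
    (E * Matrix.diagonal ν * Eᵀ) v v = ∑ j, ν j * E v j ^ 2 := by
  rw [Matrix.mul_apply]
  apply Finset.sum_congr rfl
  intro j _
  rw [Matrix.mul_diagonal, Matrix.transpose_apply]
  ring

lemma trace_le_aux {E U : Matrix V V ℝ} (hE : Eᵀ * E = 1) (hE' : E * Eᵀ = 1) (ν : V → ℝ)
    (hU : Contr U) :
    (U * (E * Matrix.diagonal ν * Eᵀ)).trace ≤ ∑ i, |ν i| ∧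
    ((U * (E * Matrix.diagonal ν * Eᵀ)).trace = ∑ i, |ν i| →
      ∀ v, |(E * Matrix.diagonal ν * Eᵀ) v v| ≤ (U * (E * Matrix.diagonal ν * Eᵀ)) v v) := by
  set K := Eᵀ * U * E with hKdef
  have hK : Contr K := by
    refine ((contr_orth ?_).mul hU).mul (contr_orth hE)
    rw [Matrix.transpose_transpose, hE']
  have htr : (U * (E * Matrix.diagonal ν * Eᵀ)).trace = ∑ j, K j j * ν j := by
    have : U * (E * Matrix.diagonal ν * Eᵀ) = (U * E * Matrix.diagonal ν) * Eᵀ := by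
      simp only [Matrix.mul_assoc]
    rw [this, Matrix.trace_mul_comm]
    have : Eᵀ * (U * E * Matrix.diagonal ν) = K * Matrix.diagonal ν := by
      simp only [hKdef, Matrix.mul_assoc]
    rw [this]
    simp [Matrix.trace, Matrix.mul_diagonal]
  have hle : ∀ j ∈ Finset.univ, K j j * ν j ≤ |ν j| := by
    intro j _
    have h1 : |K j j| ≤ 1 := by
      have := hK.diag_sq j
      exact (sq_le_one_iff_abs_le_one _).1 this
    calc K j j * ν j ≤ |K j j * ν j| := le_abs_self _
      _ = |K j j| * |ν j| := abs_mul _ _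
      _ ≤ 1 * |ν j| := by gcongr
      _ = _ := one_mul _
  refine ⟨?_, ?_⟩
  · rw [htr]
    exact Finset.sum_le_sum hle
  · intro heq v
    rw [htr, Finset.sum_eq_sum_iff_of_le hle] at heq
    have hKd : K * Matrix.diagonal ν = Matrix.diagonal (fun j => |ν j|) := by
      ext i j
      rw [Matrix.mul_diagonal]
      by_cases hij : i = j
      · subst hij
        simpa using heq i (Finset.mem_univ i)
      · rw [Matrix.diagonal_apply_ne _ hij]
        by_cases hν : ν j = 0
        · simp [hν]
        · have h1 := heq j (Finset.mem_univ j)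
          have h2 : K j j ^ 2 = 1 := by
            have h3 : (K j j) ^ 2 * (ν j) ^ 2 = 1 * ν j ^ 2 := by
              rw [← mul_pow, h1, sq_abs, one_mul]
            exact mul_right_cancel₀ (pow_ne_zero 2 hν) h3
          rw [hK.off hij h2, zero_mul]
    have hUN : U * (E * Matrix.diagonal ν * Eᵀ) =
        E * Matrix.diagonal (fun j => |ν j|) * Eᵀ := by
      rw [← hKd, hKdef]
      have : E * (Eᵀ * U * E * Matrix.diagonal ν) * Eᵀ
          = (E * Eᵀ) * (U * (E * Matrix.diagonal ν * Eᵀ)) := by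
        simp only [Matrix.mul_assoc]
      rw [this, hE', Matrix.one_mul]
    rw [hUN, conj_diag_entry, conj_diag_entry]
    refine (Finset.abs_sum_le_sum_abs _ _).trans (le_of_eq ?_)
    apply Finset.sum_congr rfl
    intro j _
    rw [abs_mul, abs_of_nonneg (sq_nonneg (E v j))]

noncomputable def rsgn (x : ℝ) : ℝ := if x = 0 then 0 else x / |x|

lemma rsgn_neg (x : ℝ) : rsgn (-x) = - rsgn x := by
  unfold rsgn
  by_cases h : x = 0 <;> simp [h, neg_div]

lemma rsgn_sq (x : ℝ) : rsgn x ^ 2 ≤ 1 := by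
  unfold rsgn
  by_cases h : x = 0
  · simp [h]
  · simp [h, div_pow]

lemma rsgn_mul (x : ℝ) : rsgn x * x = |x| := by
  unfold rsgn
  by_cases h : x = 0
  · simp [h]
  · have : |x| ≠ 0 := abs_ne_zero.2 h
    rw [if_neg h]
    field_simp
    rw [sq_abs]

lemma sgn_aux {E : Matrix V V ℝ} (hE : Eᵀ * E = 1) (hE' : E * Eᵀ = 1) (ν : V → ℝ) :
    ∃ U : Matrix V V ℝ, Contr U ∧ (U * (E * Matrix.diagonal ν * Eᵀ)).trace = ∑ i, |ν i| ∧
      ∀ S : Matrix V V ℝ, S * (E * Matrix.diagonal ν * Eᵀ) = -((E * Matrix.diagonal ν * Eᵀ) * S)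
        → S * U = -(U * S) := by
  refine ⟨E * Matrix.diagonal (fun i => rsgn (ν i)) * Eᵀ, ?_, ?_, ?_⟩
  · refine ((contr_orth hE).mul (contr_diag fun i => rsgn_sq _)).mul (contr_orth ?_)
    rw [Matrix.transpose_transpose, hE']
  · have : E * Matrix.diagonal (fun i => rsgn (ν i)) * Eᵀ * (E * Matrix.diagonal ν * Eᵀ)
        = E * Matrix.diagonal (fun i => rsgn (ν i)) * (Eᵀ * E) * Matrix.diagonal ν * Eᵀ := by
      simp only [Matrix.mul_assoc]
    rw [this, hE, Matrix.mul_one, Matrix.trace_mul_comm, ← Matrix.mul_assoc, ← Matrix.mul_assoc,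
      hE, Matrix.one_mul, Matrix.diagonal_mul_diagonal, Matrix.trace_diagonal]
    exact Finset.sum_congr rfl fun i _ => rsgn_mul _
  · intro S hS
    set K := Eᵀ * S * E with hKdef
    have conv : ∀ d : V → ℝ, S * (E * Matrix.diagonal d * Eᵀ) = E * (K * Matrix.diagonal d) * Eᵀ := by
      intro d
      have : E * (K * Matrix.diagonal d) * Eᵀ = (E * Eᵀ) * S * (E * Matrix.diagonal d * Eᵀ) := by
        simp only [hKdef, Matrix.mul_assoc]
      rw [this, hE', Matrix.one_mul]
    have conv' : ∀ d : V → ℝ, (E * Matrix.diagonal d * Eᵀ) * S = E * (Matrix.diagonal d * K) * Eᵀ := by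
      intro d
      have : E * (Matrix.diagonal d * K) * Eᵀ = (E * Matrix.diagonal d * Eᵀ) * S * (E * Eᵀ) := by
        simp only [hKdef, Matrix.mul_assoc]
      rw [this, hE', Matrix.mul_one]
    have cancel : ∀ X : Matrix V V ℝ, Eᵀ * (E * X * Eᵀ) * E = X := by
      intro X
      have : Eᵀ * (E * X * Eᵀ) * E = (Eᵀ * E) * X * (Eᵀ * E) := by
        simp only [Matrix.mul_assoc]
      rw [this, hE, Matrix.one_mul, Matrix.mul_one]
    rw [conv, conv'] at hS
    have hS2 : K * Matrix.diagonal ν = -(Matrix.diagonal ν * K) := by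
      have h := congrArg (fun X => Eᵀ * X * E) hS
      simp only [Matrix.mul_neg, Matrix.neg_mul, cancel] at h
      exact h
    have hS3 : K * Matrix.diagonal (fun i => rsgn (ν i)) =
        -(Matrix.diagonal (fun i => rsgn (ν i)) * K) := by
      ext i j
      have h := congrFun (congrFun hS2 i) j
      simp only [Matrix.mul_diagonal, Matrix.neg_apply, Matrix.diagonal_mul] at h ⊢
      by_cases hk : K i j = 0
      · simp [hk]
      · have : ν j = - ν i := by
          apply mul_left_cancel₀ hk
          linarith
        rw [this, rsgn_neg]
        ring
    rw [conv, conv', hS3]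
    simp

lemma herm_decomp {H : Matrix V V ℝ} (hH : H.IsHermitian) (c : ℝ) :
    ∃ E : Matrix V V ℝ, Eᵀ * E = 1 ∧ E * Eᵀ = 1 ∧
      H - Matrix.diagonal (fun _ => c) =
        E * Matrix.diagonal (fun i => hH.eigenvalues i - c) * Eᵀ := by
  have h1 : (hH.eigenvectorUnitary : Matrix V V ℝ)ᵀ * (hH.eigenvectorUnitary : Matrix V V ℝ) = 1 := by
    have := Unitary.coe_star_mul_self hH.eigenvectorUnitary
    simpa [Matrix.star_eq_conjTranspose] using this
  have h2 : (hH.eigenvectorUnitary : Matrix V V ℝ) * (hH.eigenvectorUnitary : Matrix V V ℝ)ᵀ = 1 := by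
    have := Unitary.coe_mul_star_self hH.eigenvectorUnitary
    simpa [Matrix.star_eq_conjTranspose] using this
  refine ⟨_, h1, h2, ?_⟩
  have h3 : H = (hH.eigenvectorUnitary : Matrix V V ℝ) * Matrix.diagonal hH.eigenvalues *
      (hH.eigenvectorUnitary : Matrix V V ℝ)ᵀ := by
    have := hH.spectral_theorem
    simpa [Unitary.conjStarAlgAut_apply, Matrix.star_eq_conjTranspose, Function.comp_def] using this
  have h4 : Matrix.diagonal (fun i => hH.eigenvalues i - c) =
      Matrix.diagonal hH.eigenvalues - c • (1 : Matrix V V ℝ) := by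
    rw [← Matrix.diagonal_one, ← Matrix.diagonal_smul, Matrix.diagonal_sub]
    simp
  have h5 : Matrix.diagonal (fun _ : V => c) = c • (1 : Matrix V V ℝ) := by
    rw [← Matrix.diagonal_one, ← Matrix.diagonal_smul]
    congr 1
    ext
    simp
  rw [h4, Matrix.mul_sub, Matrix.sub_mul, ← h3, h5]
  simp [h2]

lemma adj_sq_sum (G : SimpleGraph V) [DecidableRel G.Adj] (v : V) :
    ∑ w, (-(G.adjMatrix ℝ)) w v ^ 2 = G.degree v := by
  simp only [Matrix.neg_apply, neg_sq, SimpleGraph.adjMatrix_apply, ite_pow, one_pow]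
  simp [SimpleGraph.adj_comm, ← SimpleGraph.card_neighborFinset_eq_degree,
    SimpleGraph.neighborFinset_eq_filter]

lemma nat_aux (a : ℝ) (ha : 0 < a) (j k : ℕ) (hjk : j < k) (hj : |(j : ℝ) ^ 2 - a| ^ 2 ≤ j)
    (hk : |(k : ℝ) ^ 2 - a| ^ 2 ≤ k) : False := by
  rw [sq_abs] at hj hk
  rcases Nat.eq_zero_or_pos j with h | h
  · subst h
    norm_num at hj
    nlinarith [sq_nonneg a, mul_pos ha ha]
  · have h1 : (1 : ℝ) ≤ j := by exact_mod_cast h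
    have h2 : (j : ℝ) + 1 ≤ k := by exact_mod_cast hjk
    have e1 : -(j : ℝ) ≤ (j : ℝ) ^ 2 - a := (abs_le_of_sq_le_sq' (by nlinarith) (by linarith)).1
    have e2 : (k : ℝ) ^ 2 - a < k := lt_of_pow_lt_pow_left₀ 2 (by linarith) (by nlinarith)
    nlinarith

theorem graphEnergy_le_wLapEnergy_degSq (G : SimpleGraph V) [DecidableRel G.Adj]
    (hG : G.Colorable 2) :
    graphEnergy G ≤ wLapEnergy G (degSq G) ∧
    (wLapEnergy G (degSq G) = graphEnergy G ↔ ∀ u v : V, G.degree u = G.degree v) := by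
  have hAh := adjMatrix_isHermitian G
  set w := degSq G with hw
  set c := avgWeight w with hc
  obtain ⟨E, hE, hE', hA⟩ := herm_decomp (adjMatrix_isHermitian G) 0
  obtain ⟨F, hF, hF', hL⟩ := herm_decomp (wLaplacian_isHermitian G w) c
  have hA0 : G.adjMatrix ℝ - Matrix.diagonal (fun _ => (0 : ℝ)) = G.adjMatrix ℝ := by
    simp
  rw [hA0] at hA
  have hLD : wLaplacian G w - Matrix.diagonal (fun _ => c) =
      Matrix.diagonal (fun v => w v - c) - G.adjMatrix ℝ := by
    rw [wLaplacian, ← Matrix.diagonal_sub]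
    abel
  rw [hLD] at hL
  have hen : graphEnergy G = ∑ i, |(adjMatrix_isHermitian G).eigenvalues i - 0| := by
    simp [graphEnergy]
  obtain ⟨U, hU, hUtr, hUS⟩ := sgn_aux hE hE' (fun i => (adjMatrix_isHermitian G).eigenvalues i - 0)
  rw [← hA] at hUtr hUS
  rw [← hen] at hUtr
  have hUd : ∀ v, U v v = 0 := by
    obtain ⟨C⟩ := hG
    let s : V → ℝ := fun v => if C v = 0 then 1 else -1
    have hs : Matrix.diagonal s * G.adjMatrix ℝ = -(G.adjMatrix ℝ * Matrix.diagonal s) := by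
      ext i j
      simp only [Matrix.diagonal_mul, Matrix.neg_apply, Matrix.mul_diagonal,
        SimpleGraph.adjMatrix_apply]
      by_cases h : G.Adj i j
      · have hne := C.valid h
        have : s i = - s j := by
          simp only [s]
          by_cases h1 : C i = 0 <;> by_cases h2 : C j = 0
          · exact absurd (h1.trans h2.symm) hne
          · simp [h1, h2]
          · simp [h1, h2]
          · exfalso
            apply hne
            omega
        simp [h, this]
      · simp [h]
    intro v
    have h := congrFun (congrFun (hUS _ hs) v) v
    simp only [Matrix.diagonal_mul, Matrix.neg_apply, Matrix.mul_diagonal] at h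
    have hsv : s v ≠ 0 := by
      simp only [s]
      split_ifs <;> norm_num
    have : s v * U v v = 0 := by linarith
    exact (mul_eq_zero.1 this).resolve_left hsv
  have hdiag : ∀ v, ((-U) * (Matrix.diagonal (fun v => w v - c) - G.adjMatrix ℝ)) v v =
      (U * G.adjMatrix ℝ) v v := by
    intro v
    rw [Matrix.mul_sub, Matrix.sub_apply, Matrix.mul_diagonal]
    simp [hUd v]
  have htr : ((-U) * (Matrix.diagonal (fun v => w v - c) - G.adjMatrix ℝ)).trace =
      graphEnergy G := by
    rw [← hUtr]
    exact Finset.sum_congr rfl fun v _ => hdiag v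
  obtain ⟨hle, heq⟩ := trace_le_aux hF hF'
    (fun i => (wLaplacian_isHermitian G w).eigenvalues i - c) hU.neg
  rw [← hL, htr] at hle heq
  have hLE : wLapEnergy G w = ∑ i, |(wLaplacian_isHermitian G w).eigenvalues i - c| := rfl
  rw [← hLE] at hle heq
  refine ⟨hle, ?_, ?_⟩
  · intro h
    have hv : ∀ v, |(G.degree v : ℝ) ^ 2 - c| ^ 2 ≤ G.degree v := by
      intro v
      have h1 := heq h.symm v
      rw [hdiag v] at h1
      have h2 : (Matrix.diagonal (fun v => w v - c) - G.adjMatrix ℝ) v v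
          = (G.degree v : ℝ) ^ 2 - c := by
        simp [hw, degSq]
      rw [h2] at h1
      have h3 := hU.neg.entry (-(G.adjMatrix ℝ)) v
      rw [adj_sq_sum, neg_mul_neg] at h3
      exact (pow_le_pow_left₀ (abs_nonneg _) h1 2).trans h3
    have key : ∀ u v : V, ¬ G.degree u < G.degree v := by
      intro u v huv
      have hcpos : 0 < c := by
        rw [hc, avgWeight]
        apply div_pos
        · apply Finset.sum_pos'
          · intro i _
            exact sq_nonneg _
          · refine ⟨v, Finset.mem_univ v, ?_⟩
            have : (0 : ℝ) < G.degree v := by exact_mod_cast (by omega : 0 < G.degree v)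
            exact pow_pos this 2
        · have : Nonempty V := ⟨v⟩
          exact_mod_cast Fintype.card_pos
      exact nat_aux c hcpos _ _ huv (hv u) (hv v)
    intro u v
    have h1 := key u v
    have h2 := key v u
    omega
  · intro hreg
    refine le_antisymm ?_ hle
    have hD : (fun v => w v - c) = fun _ => 0 := by
      ext v
      have hwv : ∀ u, w u = w v := by
        intro u
        simp only [hw, degSq, hreg u v]
      have hn : (Fintype.card V : ℝ) ≠ 0 := by
        have : Nonempty V := ⟨v⟩
        exact_mod_cast Fintype.card_ne_zero
      rw [hc, avgWeight, Finset.sum_congr rfl (fun u _ => hwv u)]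
      simp only [Finset.sum_const, Finset.card_univ, nsmul_eq_mul]
      field_simp
      ring
    obtain ⟨W, hW, hWtr, -⟩ := sgn_aux hF hF'
      (fun i => (wLaplacian_isHermitian G w).eigenvalues i - c)
    rw [← hL, ← hLE, hD] at hWtr
    have h := (trace_le_aux hE hE'
      (fun i => (adjMatrix_isHermitian G).eigenvalues i - 0) hW.neg).1
    rw [← hA, ← hen] at h
    rw [← hWtr]
    refine le_trans (le_of_eq ?_) h
    congr 1
    simp
end

section
/- Let G be a connected simple graph on n vertices. Then LE_ε(G) ≤ n·MD_ε(G) + E(G), where ε is the eccentricity vertex weight. Moreover, equality holds if and only if G is self-centred. -/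
open Matrix Finset

set_option linter.unusedSectionVars false

variable {V : Type*} [Fintype V] [DecidableEq V]

/-- The eccentricity of a vertex: `ε(u) = max_v d_G(u,v)`. -/
noncomputable def ecc (G : SimpleGraph V) (u : V) : ℝ :=
  ((Finset.univ.sup fun v => G.dist u v : ℕ) : ℝ)

-- HELPERS
/-- orthogonal diagonalisation -/
structure ODec (B X : Matrix V V ℝ) (d : V → ℝ) : Prop where
  orth : X * Xᵀ = 1
  eq : B = X * Matrix.diagonal d * Xᵀ

lemma ODec.orth' {B X : Matrix V V ℝ} {d : V → ℝ} (h : ODec B X d) : Xᵀ * X = 1 :=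
  mul_eq_one_comm.mp h.orth

lemma ODec.of_herm {B : Matrix V V ℝ} (h : B.IsHermitian) :
    ∃ X, ODec B X h.eigenvalues := by
  refine ⟨(h.eigenvectorUnitary : Matrix V V ℝ), ?_, ?_⟩
  · have := Unitary.coe_mul_star_self h.eigenvectorUnitary
    simpa [Matrix.star_eq_conjTranspose] using this
  · have := h.spectral_theorem
    simpa [Unitary.conjStarAlgAut_apply, Matrix.star_eq_conjTranspose, Function.comp_def] using this

lemma diag_bound {W : Matrix V V ℝ} (hs : Wᵀ = W) (hi : W * W = 1) (j : V) :
    ∑ k, W k j ^ 2 = 1 := by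
  have h := congrFun (congrFun hi j) j
  rw [Matrix.mul_apply, Matrix.one_apply_eq] at h
  rw [← h]
  refine Finset.sum_congr rfl fun k _ => ?_
  have : W j k = W k j := congrFun (congrFun hs k) j
  rw [this]; ring

lemma diag_le {W : Matrix V V ℝ} (hs : Wᵀ = W) (hi : W * W = 1) (d : V → ℝ) :
    (W * Matrix.diagonal d).trace ≤ ∑ j, |d j| ∧
    ((W * Matrix.diagonal d).trace = ∑ j, |d j| →
      W * Matrix.diagonal d = Matrix.diagonal fun j => |d j|) := by
  have hW : ∀ j, |W j j| ≤ 1 := fun j => by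
    rw [← sq_le_one_iff_abs_le_one, ← diag_bound hs hi j]
    exact Finset.single_le_sum (f := fun k => W k j ^ 2) (fun k _ => sq_nonneg _)
      (Finset.mem_univ j)
  have hle : ∀ j ∈ Finset.univ, W j j * d j ≤ |d j| := fun j _ => by
    calc W j j * d j ≤ |W j j * d j| := le_abs_self _
      _ = |W j j| * |d j| := abs_mul _ _
      _ ≤ 1 * |d j| := mul_le_mul_of_nonneg_right (hW j) (abs_nonneg _)
      _ = |d j| := one_mul _
  have ht : (W * Matrix.diagonal d).trace = ∑ j, W j j * d j := by
    simp [Matrix.trace, Matrix.mul_diagonal]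
  rw [ht]
  refine ⟨Finset.sum_le_sum hle, fun h => ?_⟩
  rw [Finset.sum_eq_sum_iff_of_le hle] at h
  ext i j
  rw [Matrix.mul_diagonal, Matrix.diagonal_apply]
  split_ifs with hij
  · subst hij; exact h i (Finset.mem_univ _)
  · by_cases hd : d j = 0
    · simp [hd]
    · have h1 := h j (Finset.mem_univ _)
      have h2 : W j j ^ 2 = 1 := by
        have : (W j j * d j) ^ 2 = d j ^ 2 := by rw [h1, sq_abs]
        have hd2 : d j ^ 2 ≠ 0 := pow_ne_zero _ hd
        rw [mul_pow] at this
        exact mul_right_cancel₀ hd2 (by rw [this, one_mul])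
      have h3 := diag_bound hs hi j
      rw [← Finset.add_sum_erase _ _ (Finset.mem_univ j), h2] at h3
      have h4 : ∑ k ∈ Finset.univ.erase j, W k j ^ 2 = 0 := by linarith
      rw [Finset.sum_eq_zero_iff_of_nonneg (fun k _ => sq_nonneg _)] at h4
      have := h4 i (by simp [hij])
      simp [pow_eq_zero_iff] at this
      simp [this]

lemma ODec.exists_sign {B X : Matrix V V ℝ} {d : V → ℝ} (h : ODec B X d) :
    ∃ U : Matrix V V ℝ, Uᵀ = U ∧ U * U = 1 ∧ (U * B).trace = ∑ j, |d j| := by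
  let s : V → ℝ := fun j => if 0 ≤ d j then 1 else -1
  have hs : ∀ j, s j * s j = 1 := fun j => by simp only [s]; split_ifs <;> norm_num
  have hd : ∀ j, s j * d j = |d j| := fun j => by
    simp only [s]; split_ifs with h0
    · rw [abs_of_nonneg h0, one_mul]
    · rw [abs_of_neg (not_le.mp h0)]; ring
  have key : ∀ e : V → ℝ, X * Matrix.diagonal s * Xᵀ * (X * Matrix.diagonal e * Xᵀ)
      = X * Matrix.diagonal (fun j => s j * e j) * Xᵀ := fun e => by
    rw [← Matrix.diagonal_mul_diagonal]
    calc _ = X * Matrix.diagonal s * (Xᵀ * X) * Matrix.diagonal e * Xᵀ := by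
            simp only [Matrix.mul_assoc]
      _ = _ := by rw [h.orth']; simp only [Matrix.mul_assoc, Matrix.one_mul]
  refine ⟨X * Matrix.diagonal s * Xᵀ, ?_, ?_, ?_⟩
  · simp [Matrix.transpose_mul, Matrix.mul_assoc]
  · rw [key]; simp only [hs]
    rw [Matrix.diagonal_one, Matrix.mul_one, h.orth]
  · rw [h.eq, key]; simp only [hd]
    rw [Matrix.trace_mul_comm, ← Matrix.mul_assoc, h.orth', Matrix.one_mul, Matrix.trace_diagonal]

lemma ODec.trace_le {B X U : Matrix V V ℝ} {d : V → ℝ} (h : ODec B X d)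
    (hs : Uᵀ = U) (hi : U * U = 1) :
    (U * B).trace ≤ ∑ j, |d j| ∧
    ((U * B).trace = ∑ j, |d j| →
      U * B = X * Matrix.diagonal (fun j => |d j|) * Xᵀ) := by
  have hs' : (Xᵀ * U * X)ᵀ = Xᵀ * U * X := by
    simp [Matrix.transpose_mul, Matrix.mul_assoc, hs]
  have hi' : (Xᵀ * U * X) * (Xᵀ * U * X) = 1 := by
    calc _ = Xᵀ * U * (X * Xᵀ) * U * X := by simp only [Matrix.mul_assoc]
      _ = Xᵀ * (U * U) * X := by rw [h.orth]; simp only [Matrix.mul_assoc, Matrix.one_mul]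
      _ = 1 := by rw [hi, Matrix.mul_one, h.orth']
  have ht : (U * B).trace = (Xᵀ * U * X * Matrix.diagonal d).trace := by
    rw [h.eq, Matrix.trace_mul_comm U, Matrix.mul_assoc, Matrix.mul_assoc, Matrix.trace_mul_comm,
      Matrix.mul_assoc, Matrix.trace_mul_comm (Matrix.diagonal d)]
  obtain ⟨h1, h2⟩ := diag_le hs' hi' d
  rw [ht]
  refine ⟨h1, fun he => ?_⟩
  rw [← h2 he]
  calc U * B = 1 * U * B := by rw [Matrix.one_mul]
    _ = X * (Xᵀ * U * X * Matrix.diagonal d) * Xᵀ := by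
      rw [← h.orth, h.eq]; simp only [Matrix.mul_assoc]

lemma wLap_core (G : SimpleGraph V) [DecidableRel G.Adj] (w : V → ℝ) (hG : G.Connected) :
    wLapEnergy G w ≤ (Fintype.card V : ℝ) * meanDev w + graphEnergy G ∧
    (wLapEnergy G w = (Fintype.card V : ℝ) * meanDev w + graphEnergy G ↔
      ∀ u v : V, w u = w v) := by
  haveI := hG.nonempty
  have hn : (Fintype.card V : ℝ) ≠ 0 := by exact_mod_cast Fintype.card_ne_zero
  have hMD : (Fintype.card V : ℝ) * meanDev w = ∑ v, |w v - avgWeight w| := by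
    unfold meanDev; field_simp
  set c := avgWeight w with hc
  set D : Matrix V V ℝ := Matrix.diagonal fun v => w v - c with hD
  set A := G.adjMatrix ℝ with hA
  obtain ⟨X, hX⟩ := ODec.of_herm (wLaplacian_isHermitian G w)
  obtain ⟨Y, hY⟩ := ODec.of_herm (adjMatrix_isHermitian G)
  have dM : ODec (D + -A) X (fun i => (wLaplacian_isHermitian G w).eigenvalues i - c) := by
    refine ⟨hX.orth, ?_⟩
    have e1 : D + -A = wLaplacian G w - c • (1 : Matrix V V ℝ) := by
      have : D = Matrix.diagonal w - c • (1 : Matrix V V ℝ) := by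
        ext i j
        by_cases hij : i = j
        · subst hij; simp [hD]
        · simp [hD, hij]
      rw [this, wLaplacian]; abel
    have e2 : (Matrix.diagonal fun i => (wLaplacian_isHermitian G w).eigenvalues i - c)
        = Matrix.diagonal (wLaplacian_isHermitian G w).eigenvalues - c • (1 : Matrix V V ℝ) := by
      ext i j
      by_cases hij : i = j
      · subst hij; simp
      · simp [hij]
    rw [e1, e2, Matrix.mul_sub, Matrix.sub_mul, ← hX.eq, Matrix.mul_smul, Matrix.smul_mul,
      Matrix.mul_one, hX.orth]
  have dA : ODec (-A) Y (fun i => -(adjMatrix_isHermitian G).eigenvalues i) := by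
    refine ⟨hY.orth, ?_⟩
    have e2 : (Matrix.diagonal fun i => -(adjMatrix_isHermitian G).eigenvalues i)
        = -Matrix.diagonal (adjMatrix_isHermitian G).eigenvalues := by
      rw [Matrix.diagonal_neg]
    rw [e2, Matrix.mul_neg, Matrix.neg_mul, ← hY.eq]
  have dD : ODec D 1 (fun v => w v - c) := ⟨by simp, by simp [hD]⟩
  have hE : graphEnergy G = ∑ i, |-(adjMatrix_isHermitian G).eigenvalues i| := by
    simp [graphEnergy]
  have hL : wLapEnergy G w = ∑ i, |(wLaplacian_isHermitian G w).eigenvalues i - c| := rfl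
  obtain ⟨U, hs, hi, ht⟩ := dM.exists_sign
  rw [Matrix.mul_add, Matrix.trace_add] at ht
  obtain ⟨a1, a2⟩ := dA.trace_le hs hi
  obtain ⟨b1, b2⟩ := dD.trace_le hs hi
  rw [hMD, hE, hL]
  have hle := add_le_add b1 a1
  rw [ht] at hle
  refine ⟨hle, fun heq => ?_, fun hw => ?_⟩
  · have hb := b2 (by linarith)
    have ha := a2 (by linarith)
    rw [Matrix.one_mul, Matrix.transpose_one, Matrix.mul_one] at hb
    have hz : ∀ v z, G.Adj v z → w v = c := by
      intro v z hvz
      by_contra hne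
      have hne' : w v - c ≠ 0 := sub_ne_zero.mpr hne
      have hU : ∀ k, k ≠ v → U v k = 0 := fun k hk => by
        have h1 := congrFun (congrFun hb k) v
        rw [hD, Matrix.mul_diagonal, Matrix.diagonal_apply_ne _ hk] at h1
        have h2 : U v k = U k v := congrFun (congrFun hs k) v
        rw [h2]
        exact (mul_eq_zero.mp h1).resolve_right hne'
      have h0 : (U * -A) v v = 0 := by
        rw [Matrix.mul_apply]
        refine Finset.sum_eq_zero fun k _ => ?_
        by_cases hk : k = v
        · subst hk; simp [hA]
        · rw [hU k hk, zero_mul]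
      rw [ha, Matrix.mul_apply] at h0
      simp only [Matrix.mul_diagonal, Matrix.transpose_apply] at h0
      rw [Finset.sum_eq_zero_iff_of_nonneg] at h0
      · have hAz : A v z = 0 := by
          rw [hA, hY.eq, Matrix.mul_apply]
          refine Finset.sum_eq_zero fun k hk => ?_
          have := h0 k hk
          simp only [Matrix.mul_diagonal, Matrix.transpose_apply]
          simp only [mul_eq_zero, abs_eq_zero, neg_eq_zero] at this ⊢
          tauto
        simp [hA, hvz] at hAz
      · intro k _
        have : Y v k * |-(adjMatrix_isHermitian G).eigenvalues k| * Y v k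
          = Y v k ^ 2 * |-(adjMatrix_isHermitian G).eigenvalues k| := by ring
        simp only [this]
        positivity
    intro u v
    by_cases huv : u = v
    · rw [huv]
    haveI : Nontrivial V := ⟨u, v, huv⟩
    obtain ⟨y, hy⟩ := hG.preconnected.exists_adj_of_nontrivial u
    obtain ⟨z, hz'⟩ := hG.preconnected.exists_adj_of_nontrivial v
    rw [hz u y hy, hz v z hz']
  · have hwc : ∀ v, w v = c := fun v => by
      rw [hc, avgWeight, Finset.sum_congr rfl (fun x _ => hw x v)]
      simp [hn]
    have hD0 : D = 0 := by
      simp [hD, hwc]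
    refine le_antisymm hle ?_
    obtain ⟨U', hs', hi', ht'⟩ := dA.exists_sign
    obtain ⟨m1, -⟩ := dM.trace_le hs' hi'
    rw [hD0, zero_add, ht'] at m1
    simpa [hwc] using m1

theorem wLapEnergy_ecc_le (G : SimpleGraph V) [DecidableRel G.Adj]
    (hG : G.Connected) :
    wLapEnergy G (ecc G) ≤ (Fintype.card V : ℝ) * meanDev (ecc G) + graphEnergy G ∧
    (wLapEnergy G (ecc G) = (Fintype.card V : ℝ) * meanDev (ecc G) + graphEnergy G ↔
      ∀ u v : V, ecc G u = ecc G v) := by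
  exact wLap_core G (ecc G) hG
end
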